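/- Consider the random pairing model: for even n and integer d ≥ 3, choose a uniformly random perfect matching M of the set {1,…,n}×{1,…,d}, and let G_M be the multigraph on {1,…,n} in which the multiplicity between distinct vertices i ≠ i' is the number of pairs {(i,j),(i',j')} ∈ M (pairs matching two copies of the same vertex are discarded as self-loops). Let (d_n) be a sequence of integers with d_n ≥ 3 and d_n/√n → 0. If all d_n are odd, then as n → ∞ over even n, E_{M,θ}[m₂(G_M,θ)] → 2; if all d_n are even, then E_{M,θ}[m₂(G_M,θ)] → 3. Here E_{M,θ} denotes the average over the uniformly random perfect matching M of {1,…,n}×{1,…,d_n} and the uniform average (2π)^{-n} ∫_{[0,2π]^n} dθ over angles. -/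

import Mathlib

open scoped BigOperators
open MeasureTheory

noncomputable section

/-- The amplitude `2^{-n} Σ_z (−1)^{Σ_{i<j} m_{ij} z_i z_j + Σ_i x_i z_i}
Π_j exp(−i θ_j (−1)^{z_j})` of measuring the graph state of the multigraph with edge
multiplicities `m` in the X-Y plane product basis with angles `θ`, at outcome `x`. -/
def gsAmp (n : ℕ) (m : Fin n → Fin n → ℕ) (θ : Fin n → ℝ) (x : Fin n → Bool) : ℂ :=
  (1 / 2 ^ n : ℂ) * ∑ z : Fin n → Bool,
    (-1 : ℂ) ^ ((∑ i : Fin n, ∑ j : Fin n, if i < j ∧ z i ∧ z j then m i j else 0) +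
        ∑ i : Fin n, (if x i ∧ z i then 1 else 0)) *
      ∏ j : Fin n, Complex.exp (-Complex.I * (θ j : ℂ) * (-1 : ℂ) ^ (if z j then 1 else 0))

/-- The output probability `p_{G,θ}(x)`. -/
def gsProb (n : ℕ) (m : Fin n → Fin n → ℕ) (θ : Fin n → ℝ) (x : Fin n → Bool) : ℝ :=
  Complex.normSq (gsAmp n m θ x)

/-- The normalized second moment `m₂(G,θ) = 2^n Σ_x p_{G,θ}(x)²`. -/
def secondMoment (n : ℕ) (m : Fin n → Fin n → ℕ) (θ : Fin n → ℝ) : ℝ :=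
  2 ^ n * ∑ x : Fin n → Bool, (gsProb n m θ x) ^ 2

/-- The uniform average `(2π)^{-n} ∫_{[0,2π]^n} m₂(G,θ) dθ` over measurement angles. -/
def avgSecondMoment (n : ℕ) (m : Fin n → Fin n → ℕ) : ℝ :=
  ((2 * Real.pi) ^ n)⁻¹ *
    ∫ θ in Set.univ.pi (fun _ : Fin n => Set.Icc (0 : ℝ) (2 * Real.pi)), secondMoment n m θ

/-- The perfect matchings of a finite set `V`, encoded as fixed-point-free involutions. -/
def perfectMatchings (V : Type*) [Fintype V] [DecidableEq V] : Finset (Equiv.Perm V) :=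
  Finset.univ.filter fun σ => (∀ v, σ (σ v) = v) ∧ ∀ v, σ v ≠ v

/-- The multigraph of the pairing model: the multiplicity between distinct vertices
`i ≠ i'` of `{1,…,n}` is the number of pairs `{(i,j),(i',j')}` of the matching `σ` of
`{1,…,n} × {1,…,d}` (self-loops are irrelevant: only entries with `i < i'` are used). -/
def pairingMult (n d : ℕ) (σ : Equiv.Perm (Fin n × Fin d)) : Fin n → Fin n → ℕ :=
  fun i i' => (Finset.univ.filter fun j : Fin d => (σ (i, j)).1 = i').card

/-- `E_{M,θ}[m₂(G_M,θ)]` for the random pairing model: the average over the uniformly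
random perfect matching `M` of `{1,…,n}×{1,…,d}` and the uniform angle average. -/
def pairingAvgM2 (n d : ℕ) : ℝ :=
  (∑ σ ∈ perfectMatchings (Fin n × Fin d), avgSecondMoment n (pairingMult n d σ)) /
    ((perfectMatchings (Fin n × Fin d)).card : ℝ)

open MvPolynomial in
/-- The quadratic form `Σ_i X_i² - 2 Σ_{i<j} X_i X_j` in three variables. -/
def signForm : MvPolynomial (Fin 3) ℝ := 2 * ∑ i, X i ^ 2 - (∑ i, X i) ^ 2

/-- The coefficient of the monomial with exponents `π` in the `h`-th power of `signForm`. -/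
def signCoeff (h : ℕ) (π : Fin 3 → ℕ) : ℝ :=
  MvPolynomial.coeff (Finsupp.equivFunOnFinite.symm π) (signForm ^ h)

/-- The average of `∏_{uv} ±1` over the pairs `uv` of a random perfect matching of a set with
`π i` points of colour `i`, with sign `-1` for bichromatic pairs. -/
def signMean (π : Fin 3 → ℕ) : ℝ :=
  (∏ i, ((π i).factorial : ℝ)) / ((∑ i, π i).factorial : ℝ) * signCoeff ((∑ i, π i) / 2) π

open MvPolynomial in
lemma pderiv_signForm (i : Fin 3) :
    pderiv i signForm = 2 * ∑ j, (if j = i then 1 else -1 : ℝ) • X j := by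
  have h2 : pderiv i (2 : MvPolynomial (Fin 3) ℝ) = 0 := by
    rw [← map_ofNat C 2, pderiv_C]
  simp only [signForm, map_sub, pderiv_mul, h2, map_sum, pderiv_pow, pderiv_X]
  fin_cases i <;> simp [Fin.sum_univ_three] <;> ring

open MvPolynomial in
lemma signCoeff_succ (h : ℕ) (π : Fin 3 → ℕ) (i : Fin 3) :
    (π i + 1) * signCoeff (h + 1) (π + Pi.single i 1) =
      2 * (h + 1) * ∑ j, (if j = i then 1 else -1 : ℝ) *
        (if π j = 0 then 0 else signCoeff h (π - Pi.single j 1)) := by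
  have h1 := coeff_pderiv (i := i) (signForm ^ (h + 1)) (Finsupp.equivFunOnFinite.symm π)
  have e1 : (Finsupp.equivFunOnFinite.symm π + Finsupp.single i 1 : Fin 3 →₀ ℕ)
      = Finsupp.equivFunOnFinite.symm (π + Pi.single i 1) := by
    ext k; simp [Finsupp.single_apply, Pi.single_apply, eq_comm]
  have e2 : ∀ j, (Finsupp.equivFunOnFinite.symm π - Finsupp.single j 1 : Fin 3 →₀ ℕ)
      = Finsupp.equivFunOnFinite.symm (π - Pi.single j 1) := by
    intro j; ext k; simp [Finsupp.single_apply, Pi.single_apply, eq_comm]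
  have e3 : (pderiv i (signForm ^ (h + 1)) : MvPolynomial (Fin 3) ℝ) =
      ∑ j, (2 * (h + 1) * (if j = i then 1 else -1 : ℝ)) • (signForm ^ h * X j) := by
    rw [pderiv_pow, pderiv_signForm]
    simp only [smul_eq_C_mul, Finset.mul_sum, map_mul, map_add, map_one, map_ofNat, map_natCast]
    refine Finset.sum_congr rfl fun j _ => ?_
    push_cast
    split_ifs <;> simp <;> ring
  rw [e3, e1] at h1
  simp only [coeff_sum, coeff_smul, coeff_mul_X', smul_eq_mul, e2] at h1
  rw [Finset.mul_sum]
  unfold signCoeff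
  simp only [Finsupp.coe_equivFunOnFinite_symm] at h1
  rw [mul_comm, ← h1]
  refine Finset.sum_congr rfl fun j _ => ?_
  by_cases hj : π j = 0 <;> simp [hj]

lemma signMean_rec (π : Fin 3 → ℕ) (i : Fin 3) (hodd : Odd (∑ j, π j)) :
    signMean (π + Pi.single i 1) * (∑ j, π j : ℕ) =
      ∑ j, (if j = i then 1 else -1 : ℝ) * π j * signMean (π - Pi.single j 1) := by
  obtain ⟨h, hh⟩ := hodd
  have s1 : ∑ j, (π + Pi.single i 1 : Fin 3 → ℕ) j = 2 * (h + 1) := by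
    simp [Finset.sum_add_distrib, hh]; ring
  have s2 : ∀ j, π j ≠ 0 → ∑ k, (π - Pi.single j 1 : Fin 3 → ℕ) k = 2 * h := by
    intro j hj
    have : ∑ k, ((π - Pi.single j 1 : Fin 3 → ℕ) k + (Pi.single j 1 : Fin 3 → ℕ) k) = ∑ k, π k := by
      refine Finset.sum_congr rfl fun k _ => ?_
      by_cases hk : k = j
      · subst hk; simp; omega
      · simp [hk]
    rw [Finset.sum_add_distrib, hh] at this
    simp at this
    omega
  have f1 : (∏ k, (((π + Pi.single i 1 : Fin 3 → ℕ) k).factorial : ℝ)) =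
      (π i + 1) * ∏ k, ((π k).factorial : ℝ) := by
    rw [← Finset.mul_prod_erase _ _ (Finset.mem_univ i),
      ← Finset.mul_prod_erase (s := Finset.univ) (f := fun k => ((π k).factorial : ℝ)) (a := i) (Finset.mem_univ i)]
    rw [← mul_assoc]
    congr 1
    · simp [Nat.factorial_succ]
    · refine Finset.prod_congr rfl fun k hk => ?_
      simp [Finset.ne_of_mem_erase hk]
  have f2 : ∀ j, π j ≠ 0 →
      π j * (∏ k, (((π - Pi.single j 1 : Fin 3 → ℕ) k).factorial : ℝ)) =
        ∏ k, ((π k).factorial : ℝ) := by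
    intro j hj
    rw [← Finset.mul_prod_erase _ _ (Finset.mem_univ j),
      ← Finset.mul_prod_erase (s := Finset.univ) (f := fun k => ((π k).factorial : ℝ)) (a := j) (Finset.mem_univ j)]
    rw [← mul_assoc]
    congr 1
    · obtain ⟨m, hm⟩ := Nat.exists_eq_succ_of_ne_zero hj
      simp [hm, Nat.factorial_succ]
    · refine Finset.prod_congr rfl fun k hk => ?_
      simp [Finset.ne_of_mem_erase hk]
  have key := signCoeff_succ h π i
  have e : ∀ j, (π j : ℝ) * signMean (π - Pi.single j 1) =
      (∏ k, ((π k).factorial : ℝ)) / ((2 * h).factorial : ℝ) *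
        (if π j = 0 then 0 else signCoeff h (π - Pi.single j 1)) := by
    intro j
    by_cases hj : π j = 0
    · simp [hj]
    · rw [if_neg hj, ← f2 j hj, signMean, s2 j hj, Nat.mul_div_cancel_left _ two_pos]
      ring
  simp_rw [mul_assoc, e]
  rw [signMean, s1, f1, Nat.mul_div_cancel_left _ two_pos, hh]
  have : ((2 * (h + 1)).factorial : ℝ) = (2 * h + 2) * ((2 * h + 1) * (2 * h).factorial) := by
    rw [show 2 * (h + 1) = (2 * h + 1) + 1 by ring, Nat.factorial_succ, Nat.factorial_succ]
    push_cast; ring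
  rw [this]
  have hp : ((2 * h).factorial : ℝ) ≠ 0 := by positivity
  have hp2 : (2 * h + 2 : ℝ) ≠ 0 := by positivity
  have hp3 : (2 * h + 1 : ℝ) ≠ 0 := by positivity
  have key2 : (((π i : ℝ) + 1) * ∏ k, ((π k).factorial : ℝ)) /
      ((2 * h + 2) * ((2 * h + 1) * (2 * h).factorial)) * signCoeff (h + 1) (π + Pi.single i 1)
      * ((2 * h + 1 : ℕ) : ℝ) = (∏ k, ((π k).factorial : ℝ)) / (2 * h).factorial *
      ((((π i : ℝ) + 1) * signCoeff (h + 1) (π + Pi.single i 1)) / (2 * (h + 1))) := by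
    push_cast
    field_simp
  rw [key2, key, mul_div_cancel_left₀ _ (by positivity : 2 * ((h : ℝ) + 1) ≠ 0), Finset.mul_sum]
  refine Finset.sum_congr rfl fun j _ => by ring

open MvPolynomial in
lemma signCoeff_comp (h : ℕ) (π : Fin 3 → ℕ) (τ : Equiv.Perm (Fin 3)) :
    signCoeff h (π ∘ τ) = signCoeff h π := by
  have hq : rename τ signForm = signForm := by
    simp only [signForm, map_sub, map_mul, map_sum, map_pow, rename_X, map_ofNat]
    rw [Equiv.sum_comp τ (fun i => (X i : MvPolynomial (Fin 3) ℝ) ^ 2),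
      Equiv.sum_comp τ (fun i => (X i : MvPolynomial (Fin 3) ℝ))]
  have := coeff_rename_mapDomain τ τ.injective (signForm ^ h) (Finsupp.equivFunOnFinite.symm (π ∘ τ))
  rw [map_pow, hq] at this
  unfold signCoeff
  rw [← this]
  congr 1
  rw [← Finsupp.equivMapDomain_eq_mapDomain]
  ext k; simp

lemma signMean_comp (π : Fin 3 → ℕ) (τ : Equiv.Perm (Fin 3)) :
    signMean (π ∘ τ) = signMean π := by
  simp only [signMean, signCoeff_comp]
  simp only [Function.comp_apply]
  rw [Equiv.sum_comp τ π, Equiv.prod_comp τ (fun i => ((π i).factorial : ℝ))]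

lemma signMean_zero : signMean 0 = 1 := by
  have : (Finsupp.equivFunOnFinite.symm 0 : Fin 3 →₀ ℕ) = 0 := by ext; simp
  simp [signMean, signCoeff, this]

lemma abs_signMean_le_one (π : Fin 3 → ℕ) (hπ : Even (∑ j, π j)) : |signMean π| ≤ 1 := by
  induction hn : ∑ j, π j using Nat.strong_induction_on generalizing π with
  | _ n ih =>
  by_cases h0 : π = 0
  · simp [h0, signMean_zero]
  obtain ⟨i, hi⟩ : ∃ i, π i ≠ 0 := by
    by_contra! h; exact h0 (funext h)
  have sub : ∀ (ρ : Fin 3 → ℕ) (j : Fin 3), ρ j ≠ 0 →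
      (ρ - Pi.single j 1) + Pi.single j 1 = ρ := by
    intro ρ j hj; ext k
    by_cases hk : k = j
    · subst hk; simp; omega
    · simp [hk]
  have ssub : ∀ (ρ : Fin 3 → ℕ) (j : Fin 3), ρ j ≠ 0 →
      ∑ k, (ρ - Pi.single j 1 : Fin 3 → ℕ) k + 1 = ∑ k, ρ k := by
    intro ρ j hj
    conv_rhs => rw [← sub ρ j hj]
    simp [Finset.sum_add_distrib]
  set ρ := π - Pi.single i 1 with hρ
  have hρ' : ρ + Pi.single i 1 = π := sub π i hi
  have hs := ssub π i hi
  rw [hn, ← hρ] at hs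
  have hodd : Odd (∑ j, ρ j) := by
    rw [hn] at hπ
    rcases Nat.even_or_odd (∑ j, ρ j) with h | h
    · have := h.add_one; rw [hs] at this; exact absurd hπ (Nat.not_even_iff_odd.2 this)
    · exact h
  have hr := signMean_rec ρ i hodd
  rw [hρ'] at hr
  have hpos : (0 : ℝ) < (∑ j, ρ j : ℕ) := by exact_mod_cast hodd.pos
  have hb : |signMean π * (∑ j, ρ j : ℕ)| ≤ (∑ j, ρ j : ℕ) := by
    rw [hr]
    refine (Finset.abs_sum_le_sum_abs _ _).trans ?_
    push_cast
    refine Finset.sum_le_sum fun j _ => ?_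
    by_cases hj : ρ j = 0
    · simp [hj]
    · have h1 := ssub ρ j hj
      have h2 := ih (∑ k, (ρ - Pi.single j 1 : Fin 3 → ℕ) k) (by omega) (ρ - Pi.single j 1)
        (by
          rcases Nat.even_or_odd (∑ k, (ρ - Pi.single j 1 : Fin 3 → ℕ) k) with h | h
          · exact h
          · have := h.add_one; rw [h1] at this; exact absurd hodd (Nat.not_odd_iff_even.2 this)) rfl
      rw [abs_mul, abs_mul]
      have h3 : |(if j = i then 1 else -1 : ℝ)| = 1 := by split_ifs <;> simp
      rw [h3, one_mul, Nat.abs_cast]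
      nlinarith [(Nat.cast_nonneg (ρ j) : (0 : ℝ) ≤ ρ j)]
  rw [abs_mul, Nat.abs_cast] at hb
  exact le_of_mul_le_mul_right (by simpa using hb) hpos

lemma signMean_rec_zero (p q r : ℕ) (h : Odd (p + q + r)) :
    signMean ![p + 1, q, r] * (p + q + r) = p * signMean ![p - 1, q, r]
      - q * signMean ![p, q - 1, r] - r * signMean ![p, q, r - 1] := by
  have := signMean_rec ![p, q, r] 0 (by simpa [Fin.sum_univ_three] using h)
  have e : ∀ a b c a' b' c' : ℕ, (![a, b, c] : Fin 3 → ℕ) + ![a', b', c'] = ![a + a', b + b', c + c'] := by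
    intros; simp
  have e0 : (Pi.single 0 1 : Fin 3 → ℕ) = ![1, 0, 0] := by ext k; fin_cases k <;> rfl
  have e1 : (Pi.single 1 1 : Fin 3 → ℕ) = ![0, 1, 0] := by ext k; fin_cases k <;> rfl
  have e2 : (Pi.single 2 1 : Fin 3 → ℕ) = ![0, 0, 1] := by ext k; fin_cases k <;> rfl
  simp [Fin.sum_univ_three, e0, e1, e2] at this
  linarith

lemma signMean_swap01 (p q r : ℕ) : signMean ![p, q, r] = signMean ![q, p, r] := by
  rw [← signMean_comp ![p, q, r] (Equiv.swap 0 1)]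
  congr 1; ext k; fin_cases k <;> rfl

lemma signMean_swap02 (p q r : ℕ) : signMean ![p, q, r] = signMean ![r, q, p] := by
  rw [← signMean_comp ![p, q, r] (Equiv.swap 0 2)]
  congr 1; ext k; fin_cases k <;> rfl

lemma signMean_add_signMean (p q r : ℕ) (h : Odd (p + q + r)) :
    (signMean ![p, q + 1, r] + signMean ![p, q, r + 1]) * (p + q + r)
      = -2 * p * signMean ![p - 1, q, r] := by
  have h1 := signMean_rec_zero q p r (by rwa [add_comm q p])
  have h2 := signMean_rec_zero r q p (by rwa [show r + q + p = p + q + r by ring])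
  rw [signMean_swap01 (q + 1), signMean_swap01 (q - 1), signMean_swap01 q (p - 1),
    signMean_swap01 q p] at h1
  rw [signMean_swap02 (r + 1), signMean_swap02 (r - 1), signMean_swap02 r q (p - 1),
    signMean_swap02 r (q - 1)] at h2
  linarith

lemma signMean_zero_left (q r : ℕ) (h : Even (q + r)) : signMean ![0, q, r] = (-1) ^ r := by
  induction hn : q + r using Nat.strong_induction_on generalizing q r with
  | _ n ih =>
  rcases q with _ | q
  · rcases r with _ | r
    · rw [pow_zero, ← signMean_zero]; congr 1; ext k; fin_cases k <;> rfl
    · rcases r with _ | r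
      · simp at h
      · have h' : Even r := by simpa [Nat.even_add_one] using h
        have h1 := signMean_rec_zero (r + 1) 0 0 (by simpa [Nat.odd_add_one] using h')
        rw [signMean_swap02]
        have h2 := ih r (by omega) 0 r (by simpa using h') (by omega)
        rw [signMean_swap02] at h2
        simp [h2, h'.neg_one_pow] at h1
        have h3 : (-1 : ℝ) ^ (r + 1 + 1) = 1 := Even.neg_one_pow (by simpa using h)
        rw [h3]
        have : (r + 1 : ℝ) ≠ 0 := by positivity
        have h4 : (signMean ![r + 1 + 1, 0, 0] - 1) * (r + 1) = 0 := by linarith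
        rcases mul_eq_zero.1 h4 with h5 | h5
        · linarith
        · exact absurd h5 this
  · have hodd : Odd (q + r) := by
      rw [← Nat.not_even_iff_odd]; intro h'
      have : q + 1 + r = q + r + 1 := by ring
      rw [this] at h; exact (Nat.not_even_iff_odd.2 h'.add_one) h
    have h1 := signMean_rec_zero q 0 r (by simpa using hodd)
    rw [signMean_swap01]
    have e1 : (q : ℝ) * signMean ![q - 1, 0, r] = q * (-1) ^ r := by
      rcases q with _ | q
      · simp
      · congr 1
        have := ih (q + r) (by omega) q r (by
          rcases hodd with ⟨k, hk⟩; exact ⟨k, by omega⟩) rfl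
        rw [signMean_swap01] at this
        simpa using this
    have e2 : (r : ℝ) * signMean ![q, 0, r - 1] = - (r * (-1) ^ r) := by
      rcases r with _ | r
      · simp
      · have := ih (q + r) (by omega) q r (by
          rcases hodd with ⟨k, hk⟩; exact ⟨k, by omega⟩) rfl
        rw [signMean_swap01] at this
        simp [this, pow_succ]
    rw [e1, e2] at h1
    have hpos : (0 : ℝ) < q + r := by exact_mod_cast hodd.pos
    have h4 : (signMean ![q + 1, 0, r] - (-1) ^ r) * (q + r) = 0 := by
      push_cast at h1; linarith
    rcases mul_eq_zero.1 h4 with h5 | h5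
    · linarith
    · exact absurd h5 hpos.ne'

lemma abs_signMean_le_pow {z Y K p₀ : ℝ} (hz : 0 < z) (hK : 0 < K) (hYK : Y < K)
    (hrec : Y / K * z + 3 * p₀ / K ≤ z ^ 2) (p q r : ℕ) (hp : p ≤ p₀) (heven : Even (p + q + r))
    (hY : |(q : ℝ) - r| + p ≤ Y) (hqr : K + 2 * p ≤ q + r) :
    |signMean ![p, q, r]| ≤ z ^ p := by
  induction p using Nat.strong_induction_on generalizing q r with
  | _ p ih =>
  rcases p with _ | p
  · rw [pow_zero]
    exact abs_signMean_le_one _ (by simpa [Fin.sum_univ_three] using heven)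
  have hY0 : 0 ≤ Y := by
    have := abs_nonneg ((q : ℝ) - r)
    push_cast at hY
    linarith [(Nat.cast_nonneg p : (0:ℝ) ≤ p)]
  have hp₀ : 0 ≤ p₀ := le_trans (Nat.cast_nonneg _) hp
  push_cast at hp hY hqr
  have hpn : (0 : ℝ) ≤ p := Nat.cast_nonneg p
  have hab := abs_le.1 (show |(q : ℝ) - r| ≤ Y by linarith)
  have hq : q ≠ 0 := by rintro rfl; push_cast at *; linarith
  have hr : r ≠ 0 := by rintro rfl; push_cast at *; linarith
  obtain ⟨q, rfl⟩ := Nat.exists_eq_succ_of_ne_zero hq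
  obtain ⟨r, rfl⟩ := Nat.exists_eq_succ_of_ne_zero hr
  simp only [Nat.succ_eq_add_one] at *
  push_cast at hY hqr hab
  have hev : Even (p + q + r + 1) := by
    rcases heven with ⟨k, hk⟩; exact ⟨k - 1, by omega⟩
  have hodd : Odd (p + q + r) := by
    rcases hev with ⟨k, hk⟩; exact ⟨k - 1, by omega⟩
  have h1 := signMean_rec_zero p (q + 1) (r + 1) (by rcases hodd with ⟨k, hk⟩; exact ⟨k + 1, by omega⟩)
  have h2 := signMean_add_signMean p q r hodd
  have hpos : (1 : ℝ) ≤ p + q + r := by exact_mod_cast hodd.pos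
  simp only [Nat.add_sub_cancel] at h1
  push_cast at h1
  have hN : (0 : ℝ) < p + (q + 1) + (r + 1) := by positivity
  have hKN : K ≤ p + (q + 1) + (r + 1) := by linarith
  have bA : |(p : ℝ) * signMean ![p - 1, q + 1, r + 1]| * z ≤ p * z ^ p := by
    rcases p with _ | p
    · simp
    · have := ih p (by omega) (q + 1) (r + 1) (by push_cast at hp; linarith)
        (by rcases heven with ⟨k, hk⟩; exact ⟨k - 1, by omega⟩)
        (by push_cast at hY ⊢; linarith) (by push_cast at hqr ⊢; linarith)
      rw [abs_mul, Nat.abs_cast, Nat.add_sub_cancel, pow_succ, ← mul_assoc]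
      gcongr
  have bB : |2 * (p : ℝ) * signMean ![p - 1, q, r]| * z ≤ 2 * p * z ^ p := by
    rcases p with _ | p
    · simp
    · have := ih p (by omega) q r (by push_cast at hp; linarith)
        (by rcases heven with ⟨k, hk⟩; exact ⟨k - 2, by omega⟩)
        (by push_cast at hY ⊢; simp only [add_sub_add_right_eq_sub] at hY; linarith)
        (by push_cast at hqr ⊢; linarith)
      rw [abs_mul, abs_of_nonneg (by positivity), Nat.add_sub_cancel, pow_succ, ← mul_assoc]
      gcongr
  have bC : |signMean ![p, q + 1, r]| ≤ z ^ p := by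
    refine ih p (by omega) (q + 1) r (by linarith)
        (by rcases hev with ⟨k, hk⟩; exact ⟨k, by omega⟩) ?_ (by push_cast at hqr ⊢; linarith)
    push_cast
    have : |(q : ℝ) + 1 - r| ≤ |(q : ℝ) + 1 - (r + 1)| + 1 := by
      calc |(q : ℝ) + 1 - r| = |((q : ℝ) + 1 - (r + 1)) + 1| := by ring_nf
        _ ≤ _ := (abs_add_le _ _).trans (by simp)
    linarith
  -- the recursion, with the two terms of size `N` combined into a difference
  have h3 : signMean ![p + 1, q + 1, r + 1] * (p + (q + 1) + (r + 1)) =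
      p * signMean ![p - 1, q + 1, r + 1] +
      ((q + 1) / (p + q + r)) * (2 * p * signMean ![p - 1, q, r])
      + (q - r) * signMean ![p, q + 1, r] := by
    have h2' : signMean ![p, q, r + 1] = -(2 * p * signMean ![p - 1, q, r]) / (p + q + r)
        - signMean ![p, q + 1, r] := by
      field_simp
      linarith
    rw [h1, h2']
    field_simp
    ring
  have bB' : |((q + 1 : ℝ) / (p + q + r)) * (2 * p * signMean ![p - 1, q, r])| * z ≤ 2 * p * z ^ p := by
    rcases Nat.eq_zero_or_pos p with h0 | h0
    · simp [h0]
    · have h0' : (1 : ℝ) ≤ p := by exact_mod_cast h0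
      have hle : (q + 1 : ℝ) / (p + q + r) ≤ 1 := by
        rw [div_le_one (by linarith)]
        have : (0 : ℝ) ≤ r := Nat.cast_nonneg r
        linarith
      rw [abs_mul, abs_of_nonneg (by positivity), mul_assoc]
      exact (mul_le_of_le_one_left (by positivity) hle).trans bB
  have bC' : |((q : ℝ) - r) * signMean ![p, q + 1, r]| * z ≤ Y * z * z ^ p := by
    rw [abs_mul]
    have : |(q : ℝ) - r| ≤ Y := by
      simp only [add_sub_add_right_eq_sub] at hY; linarith
    calc |(q : ℝ) - r| * |signMean ![p, q + 1, r]| * z ≤ Y * z ^ p * z := by gcongr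
      _ = _ := by ring
  have h4 : |signMean ![p + 1, q + 1, r + 1]| * (p + (q + 1) + (r + 1)) * z ≤
      (3 * p₀ + Y * z) * z ^ p := by
    have : |signMean ![p + 1, q + 1, r + 1]| * (p + (q + 1) + (r + 1)) =
      |signMean ![p + 1, q + 1, r + 1] * (p + (q + 1) + (r + 1))| := by
      rw [abs_mul, abs_of_pos hN]
    rw [this, h3]
    refine (mul_le_mul_of_nonneg_right (abs_add_three _ _ _) hz.le).trans ?_
    have : (3 * p₀ + Y * z) * z ^ p ≥ (p + 2 * p + Y * z) * z ^ p := by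
      gcongr; linarith
    nlinarith
  have h5 : 3 * p₀ + Y * z ≤ z ^ 2 * K := by
    have := mul_le_mul_of_nonneg_right hrec hK.le
    rw [add_mul] at this
    field_simp at this
    linarith
  have h6 : |signMean ![p + 1, q + 1, r + 1]| * (K * z) ≤ z ^ (p + 1) * (K * z) := by
    calc |signMean ![p + 1, q + 1, r + 1]| * (K * z)
        ≤ |signMean ![p + 1, q + 1, r + 1]| * ((p + (q + 1) + (r + 1)) * z) := by gcongr
      _ ≤ (3 * p₀ + Y * z) * z ^ p := by rw [← mul_assoc]; exact h4
      _ ≤ z ^ 2 * K * z ^ p := by gcongr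
      _ = _ := by ring
  exact le_of_mul_le_mul_right h6 (by positivity)

lemma sum_rootOfUnity_pow {L : ℕ} {ζ : ℂ} (hζ : IsPrimitiveRoot ζ L) {a b : ℕ} (ha : a < L)
    (hb : b < L) : ∑ j : Fin L, (ζ ^ (j : ℕ)) ^ a * ((ζ ^ (j : ℕ)) ^ b)⁻¹ = if a = b then (L : ℂ) else 0 := by
  have hL : 0 < L := by omega
  have h0 : ζ ≠ 0 := hζ.ne_zero hL.ne'
  have e : ∀ j : ℕ, (ζ ^ j) ^ a * ((ζ ^ j) ^ b)⁻¹ = (ζ ^ a * (ζ ^ b)⁻¹) ^ j := by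
    intro j
    rw [mul_pow, inv_pow, ← pow_mul, ← pow_mul, ← pow_mul, ← pow_mul, mul_comm j a, mul_comm j b]
  simp_rw [e]
  rw [Fin.sum_univ_eq_sum_range (fun j => (ζ ^ a * (ζ ^ b)⁻¹) ^ j)]
  split_ifs with hab
  · subst hab
    simp [mul_inv_cancel₀ (pow_ne_zero a h0)]
  · have hx : ζ ^ a * (ζ ^ b)⁻¹ ≠ 1 := by
      intro h
      rw [mul_inv_eq_one₀ (pow_ne_zero b h0)] at h
      exact hab (hζ.pow_inj ha hb h)
    rw [geom_sum_eq hx, mul_pow, inv_pow, ← pow_mul, ← pow_mul, mul_comm a, mul_comm b, pow_mul, pow_mul,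
      hζ.pow_eq_one]
    simp

/-- Cauchy's estimate for the coefficients of a real polynomial in several variables. -/
lemma abs_coeff_mul_prod_pow_le {ι : Type*} [Fintype ι] [DecidableEq ι] (P : MvPolynomial ι ℝ)
    (m : ι →₀ ℕ) (ρ : ι → ℝ) (hρ : ∀ i, 0 ≤ ρ i) (B : ℝ)
    (hB : ∀ x : ι → ℂ, (∀ i, ‖x i‖ = ρ i) → ‖MvPolynomial.aeval x P‖ ≤ B) :
    |MvPolynomial.coeff m P| * ∏ i, ρ i ^ m i ≤ B := by
  obtain ⟨L, hL⟩ : ∃ L : ℕ, (∀ i, m i < L) ∧ ∀ k ∈ P.support, ∀ i, k i < L := by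
    refine ⟨(∑ i, m i) + (∑ k ∈ P.support, ∑ i, k i) + 1, fun i => ?_, fun k hk i => ?_⟩
    · have := Finset.single_le_sum (f := fun i => m i) (fun _ _ => Nat.zero_le _) (Finset.mem_univ i)
      omega
    · have h1 := Finset.single_le_sum (f := fun i => k i) (fun _ _ => Nat.zero_le _) (Finset.mem_univ i)
      have h2 := Finset.single_le_sum (f := fun k : ι →₀ ℕ => ∑ i, k i) (fun _ _ => Nat.zero_le _) hk
      omega
  rcases isEmpty_or_nonempty ι with hι | hι
  · have h := hB (fun i => 0) (fun i => hι.elim i)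
    have hP := P.eq_C_of_isEmpty
    rw [hP] at h ⊢
    have hm : m = 0 := Subsingleton.elim _ _
    simpa [hm] using h
  obtain ⟨i₀⟩ := hι
  have hLpos : 0 < L := (Nat.zero_le _).trans_lt (hL.1 i₀)
  have hζ := Complex.isPrimitiveRoot_exp L hLpos.ne'
  set ζ := Complex.exp (2 * Real.pi * Complex.I / L) with hζdef
  have hn : ‖ζ‖ = 1 := hζ.norm'_eq_one hLpos.ne'
  have key : ∑ j : ι → Fin L, MvPolynomial.aeval (fun i => (ρ i : ℂ) * ζ ^ (j i : ℕ)) P *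
      ∏ i, ((ζ ^ (j i : ℕ)) ^ m i)⁻¹ =
      (L : ℂ) ^ Fintype.card ι * (MvPolynomial.coeff m P * ∏ i, (ρ i : ℂ) ^ m i) := by
    have e1 : ∀ j : ι → Fin L, MvPolynomial.aeval (fun i => (ρ i : ℂ) * ζ ^ (j i : ℕ)) P *
        ∏ i, ((ζ ^ (j i : ℕ)) ^ m i)⁻¹ = ∑ k ∈ P.support, ((MvPolynomial.coeff k P : ℝ) : ℂ) *
          (∏ i, (ρ i : ℂ) ^ k i) * ∏ i, ((ζ ^ (j i : ℕ)) ^ k i * ((ζ ^ (j i : ℕ)) ^ m i)⁻¹) := by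
      intro j
      rw [MvPolynomial.aeval_def, MvPolynomial.eval₂_eq', Finset.sum_mul]
      refine Finset.sum_congr rfl fun k _ => ?_
      simp only [mul_pow, Finset.prod_mul_distrib, Complex.coe_algebraMap]
      ring
    simp_rw [e1]
    rw [Finset.sum_comm]
    have e2 : ∀ k ∈ P.support, ∑ j : ι → Fin L, ((MvPolynomial.coeff k P : ℝ) : ℂ) *
          (∏ i, (ρ i : ℂ) ^ k i) * ∏ i, ((ζ ^ (j i : ℕ)) ^ k i * ((ζ ^ (j i : ℕ)) ^ m i)⁻¹) =
          if k = m then (L : ℂ) ^ Fintype.card ι * (MvPolynomial.coeff m P * ∏ i, (ρ i : ℂ) ^ m i) else 0 := by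
      intro k hk
      rw [← Finset.mul_sum]
      have := Finset.prod_univ_sum (fun _ : ι => (Finset.univ : Finset (Fin L)))
        (fun i j => (ζ ^ (j : ℕ)) ^ k i * ((ζ ^ (j : ℕ)) ^ m i)⁻¹)
      rw [Fintype.piFinset_univ] at this
      rw [← this]
      simp_rw [fun i => sum_rootOfUnity_pow hζ (hL.2 k hk i) (hL.1 i)]
      split_ifs with hkm
      · subst hkm; simp; ring
      · obtain ⟨i, hi⟩ : ∃ i, k i ≠ m i := by
          by_contra! h; exact hkm (Finsupp.ext h)
        have h0 : ∏ i, (if k i = m i then (L : ℂ) else 0) = 0 :=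
          Finset.prod_eq_zero (Finset.mem_univ i) (if_neg hi)
        rw [h0, mul_zero]
    rw [Finset.sum_congr rfl e2, Finset.sum_ite_eq']
    split_ifs with hm
    · rfl
    · rw [MvPolynomial.notMem_support_iff.1 hm]; simp
  have hle : ‖∑ j : ι → Fin L, MvPolynomial.aeval (fun i => (ρ i : ℂ) * ζ ^ (j i : ℕ)) P *
      ∏ i, ((ζ ^ (j i : ℕ)) ^ m i)⁻¹‖ ≤ (L : ℝ) ^ Fintype.card ι * B := by
    refine (norm_sum_le _ _).trans ?_
    have : ∀ j ∈ (Finset.univ : Finset (ι → Fin L)),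
        ‖MvPolynomial.aeval (fun i => (ρ i : ℂ) * ζ ^ (j i : ℕ)) P *
      ∏ i, ((ζ ^ (j i : ℕ)) ^ m i)⁻¹‖ ≤ B := by
      intro j _
      rw [norm_mul, norm_prod]
      simp only [norm_inv, norm_pow, hn, one_pow, inv_one, Finset.prod_const_one, mul_one]
      apply hB
      intro i
      rw [norm_mul, norm_pow, hn, one_pow, mul_one, Complex.norm_real, Real.norm_of_nonneg (hρ i)]
    refine (Finset.sum_le_sum this).trans ?_
    simp
  rw [key, norm_mul, norm_mul, norm_pow, norm_prod] at hle
  simp only [Complex.norm_real, Complex.norm_natCast, norm_pow] at hle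
  have hLp : (0 : ℝ) < (L : ℝ) ^ Fintype.card ι := by positivity
  have := le_of_mul_le_mul_left hle hLp
  simpa [abs_of_nonneg, hρ] using this

lemma norm_signForm_le (x : Fin 3 → ℂ) :
    ‖MvPolynomial.aeval x signForm‖ ≤ 2 * ∑ i, ‖x i‖ ^ 2 := by
  have e : MvPolynomial.aeval x signForm = (x 0 - x 1) ^ 2 + x 2 ^ 2 - 2 * x 2 * (x 0 + x 1) := by
    simp [signForm, Fin.sum_univ_three]; ring
  have hpar := parallelogram_law_with_norm ℝ (x 0) (x 1)
  rw [e, Fin.sum_univ_three]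
  have h1 : ‖(x 0 - x 1) ^ 2 + x 2 ^ 2 - 2 * x 2 * (x 0 + x 1)‖ ≤
      ‖x 0 - x 1‖ ^ 2 + ‖x 2‖ ^ 2 + 2 * ‖x 2‖ * ‖x 0 + x 1‖ := by
    refine (norm_sub_le _ _).trans (add_le_add ((norm_add_le _ _).trans ?_) ?_) <;> simp
  nlinarith [sq_nonneg (‖x 0 + x 1‖ - ‖x 2‖)]

lemma norm_signForm_le_of_sorted (x : Fin 3 → ℂ) (h01 : ‖x 1‖ ≤ ‖x 0‖) (h12 : ‖x 2‖ ≤ ‖x 1‖)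
    (h1 : ∑ i, ‖x i‖ ≤ 20 * ‖x 1‖) :
    ‖MvPolynomial.aeval x signForm‖ ≤ (∑ i, ‖x i‖) ^ 2 - (∑ i, ‖x i‖) * ‖x 2‖ / 5 := by
  have e : MvPolynomial.aeval x signForm = (x 0 - x 1) ^ 2 + x 2 ^ 2 - 2 * x 2 * (x 0 + x 1) := by
    simp [signForm, Fin.sum_univ_three]; ring
  have hpar := parallelogram_law_with_norm ℝ (x 0) (x 1)
  rw [e]
  rw [Fin.sum_univ_three] at *
  have h2 : ‖(x 0 - x 1) ^ 2 + x 2 ^ 2 - 2 * x 2 * (x 0 + x 1)‖ ≤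
      ‖x 0 - x 1‖ ^ 2 + ‖x 2‖ ^ 2 + 2 * ‖x 2‖ * ‖x 0 + x 1‖ := by
    refine (norm_sub_le _ _).trans (add_le_add ((norm_add_le _ _).trans ?_) ?_) <;> simp
  have h3 : ‖x 0‖ - ‖x 1‖ ≤ ‖x 0 + x 1‖ := norm_sub_le_norm_add _ _
  have h4 := norm_nonneg (x 2)
  refine h2.trans ?_
  generalize ‖x 0 + x 1‖ = s at *
  generalize ‖x 0 - x 1‖ = u at *
  generalize ‖x 0‖ = X at *
  generalize ‖x 1‖ = Y at *
  generalize ‖x 2‖ = Z at *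
  have hu : u ^ 2 = 2 * (X * X + Y * Y) - s * s := by linarith
  rw [hu]
  rcases le_total (X - Y) Z with hc | hc
  · nlinarith [sq_nonneg (s - Z), mul_nonneg (sub_nonneg.2 h01) (sub_nonneg.2 hc),
      mul_nonneg h4 (sub_nonneg.2 h01), mul_nonneg h4 (sub_nonneg.2 h12), mul_nonneg h4 h4]
  · nlinarith [mul_nonneg (sub_nonneg.2 hc) (sub_nonneg.2 h3), mul_nonneg h4 (sub_nonneg.2 h1),
      sq_nonneg (s - X + Y)]

lemma pow_mul_factorial_le (a k : ℕ) : a ^ k * a.factorial ≤ a ^ a * k.factorial := by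
  rcases le_total a k with h | h
  · obtain ⟨l, rfl⟩ := Nat.exists_eq_add_of_le h
    rw [pow_add, mul_assoc]
    refine Nat.mul_le_mul_left _ (le_trans ?_ (Nat.factorial_mul_pow_le_factorial (n := l)))
    rw [mul_comm]
    exact Nat.mul_le_mul_left _ (Nat.pow_le_pow_left (Nat.le_succ a) l)
  · have h1 := Nat.factorial_mul_descFactorial (Nat.sub_le a k)
    rw [Nat.sub_sub_self h] at h1
    have h2 := Nat.descFactorial_le_pow a (a - k)
    calc a ^ k * a.factorial = a ^ k * (k.factorial * a.descFactorial (a - k)) := by rw [h1]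
      _ ≤ a ^ k * (k.factorial * a ^ (a - k)) := by gcongr
      _ = a ^ a * k.factorial := by
        rw [mul_comm k.factorial, ← mul_assoc, ← pow_add, Nat.add_sub_cancel' h]

lemma add_pow_add_mul_factorial_le (a b : ℕ) :
    (a + b) ^ (a + b) * (a.factorial * b.factorial) ≤
      (a + b + 1) * (a + b).factorial * (a ^ a * b ^ b) := by
  rw [add_pow, Finset.sum_mul, mul_assoc]
  have : ∀ k ∈ Finset.range (a + b + 1),
      a ^ k * b ^ (a + b - k) * (a + b).choose k * (a.factorial * b.factorial) ≤
        (a + b).factorial * (a ^ a * b ^ b) := by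
    intro k hk
    have hk : k ≤ a + b := Nat.lt_succ_iff.1 (Finset.mem_range.1 hk)
    have h1 := Nat.choose_mul_factorial_mul_factorial hk
    calc _ = (a ^ k * a.factorial) * (b ^ (a + b - k) * b.factorial) * (a + b).choose k := by ring
      _ ≤ (a ^ a * k.factorial) * (b ^ b * (a + b - k).factorial) * (a + b).choose k := by
        exact Nat.mul_le_mul_right _
          (Nat.mul_le_mul (pow_mul_factorial_le _ _) (pow_mul_factorial_le _ _))
      _ = ((a + b).choose k * k.factorial * (a + b - k).factorial) * (a ^ a * b ^ b) := by ring
      _ = _ := by rw [h1]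
  refine (Finset.sum_le_sum this).trans ?_
  simp

lemma sum_pow_sum_mul_prod_factorial_le (π : Fin 3 → ℕ) :
    (∑ i, π i) ^ (∑ i, π i) * ∏ i, (π i).factorial ≤
      ((∑ i, π i) + 1) ^ 2 * (∑ i, π i).factorial * ∏ i, π i ^ π i := by
  rw [Fin.sum_univ_three, Fin.prod_univ_three, Fin.prod_univ_three]
  have h1 := add_pow_add_mul_factorial_le (π 0) (π 1)
  have h2 := add_pow_add_mul_factorial_le (π 0 + π 1) (π 2)
  refine Nat.le_of_mul_le_mul_right ?_ (Nat.factorial_pos (π 0 + π 1))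
  generalize π 0 = a at *
  generalize π 1 = b at *
  generalize π 2 = c at *
  calc (a + b + c) ^ (a + b + c) * (a.factorial * b.factorial * c.factorial) * (a + b).factorial
      = ((a + b + c) ^ (a + b + c) * ((a + b).factorial * c.factorial)) *
        (a.factorial * b.factorial) := by ring
    _ ≤ ((a + b + c + 1) * (a + b + c).factorial * ((a + b) ^ (a + b) * c ^ c)) *
        (a.factorial * b.factorial) := by gcongr
    _ = (a + b + c + 1) * (a + b + c).factorial * c ^ c *
        ((a + b) ^ (a + b) * (a.factorial * b.factorial)) := by ring
    _ ≤ (a + b + c + 1) * (a + b + c).factorial * c ^ c *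
        ((a + b + 1) * (a + b).factorial * (a ^ a * b ^ b)) := by gcongr
    _ ≤ (a + b + c + 1) * (a + b + c).factorial * c ^ c *
        ((a + b + c + 1) * (a + b).factorial * (a ^ a * b ^ b)) := by
      refine Nat.mul_le_mul_left _ (Nat.mul_le_mul_right _ (Nat.mul_le_mul_right _ ?_))
      omega
    _ = _ := by ring

lemma natCast_self_pow_pos (k : ℕ) : 0 < (k : ℝ) ^ k := by
  rcases Nat.eq_zero_or_pos k with rfl | h
  · simp
  · positivity

lemma abs_signMean_mul_le (π : Fin 3 → ℕ) :
    |signMean π| * (∑ i, π i : ℕ) ^ (∑ i, π i) ≤ ((∑ i, π i : ℕ) + 1 : ℝ) ^ 2 *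
      ((∏ i, (π i : ℝ) ^ π i) * |signCoeff ((∑ i, π i) / 2) π|) := by
  have h : ((∑ i, π i : ℕ) : ℝ) ^ (∑ i, π i) * ∏ i, ((π i).factorial : ℝ) ≤
      ((∑ i, π i : ℕ) + 1 : ℝ) ^ 2 * ((∑ i, π i).factorial : ℝ) * ∏ i, (π i : ℝ) ^ π i := by
    exact_mod_cast sum_pow_sum_mul_prod_factorial_le π
  unfold signMean
  have hN : (0 : ℝ) < ((∑ i, π i).factorial : ℝ) := by positivity
  rw [abs_mul, abs_of_nonneg (by positivity)]
  generalize hs0 : |signCoeff ((∑ i, π i) / 2) π| = s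
  have hs : 0 ≤ s := hs0 ▸ abs_nonneg _
  generalize (∑ i, π i) = N at *
  rw [div_mul_eq_mul_div, div_mul_eq_mul_div, div_le_iff₀ hN]
  calc _ = ((N : ℝ) ^ N * ∏ i, ((π i).factorial : ℝ)) * s := by ring
    _ ≤ _ := mul_le_mul_of_nonneg_right h hs
    _ = _ := by ring

/-- A Gaussian-type bound for `signMean`. -/
lemma signMean_sq_mul_le (π : Fin 3 → ℕ) (hπ : Even (∑ i, π i)) :
    signMean π ^ 2 * (∑ i, π i : ℕ) ^ (∑ i, π i) ≤ (((∑ i, π i : ℕ) + 1 : ℝ) ^ 2) ^ 2 *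
      2 ^ (∑ i, π i) * ∏ i, (π i : ℝ) ^ π i := by
  have h1 := abs_signMean_mul_le π
  obtain ⟨h, hh⟩ := hπ
  have h2 := abs_coeff_mul_prod_pow_le (signForm ^ ((∑ i, π i) / 2)) (Finsupp.equivFunOnFinite.symm π)
    (fun i => √(π i)) (fun i => Real.sqrt_nonneg _) ((2 * (∑ i, π i : ℕ)) ^ ((∑ i, π i) / 2)) (by
      intro x hx
      rw [map_pow, norm_pow]
      refine pow_le_pow_left₀ (norm_nonneg _) ((norm_signForm_le x).trans ?_) _
      simp [hx])
  change |signCoeff _ π| * ∏ i, √(π i : ℝ) ^ π i ≤ _ at h2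
  have hpos : 0 < ((∑ i, π i : ℕ) : ℝ) ^ (∑ i, π i) := natCast_self_pow_pos _
  have hhalf : (∑ i, π i) / 2 = h := by omega
  have h3 := pow_le_pow_left₀ (by positivity) h2 2
  rw [mul_pow, ← Finset.prod_pow] at h3
  simp_rw [← pow_mul, mul_comm _ 2, pow_mul, Real.sq_sqrt (Nat.cast_nonneg _)] at h3
  rw [← pow_mul, hhalf, show 2 * h = ∑ i, π i by omega, mul_pow] at h3
  have h4 := pow_le_pow_left₀ (by positivity) h1 2
  rw [hhalf] at h4
  have hR : 0 ≤ ∏ i, (π i : ℝ) ^ π i := by positivity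
  rw [mul_pow, sq_abs, mul_pow, mul_pow] at h4
  generalize ((∑ i, π i : ℕ) + 1 : ℝ) ^ 2 = P at *
  generalize ∏ i, (π i : ℝ) ^ π i = R at *
  generalize ((∑ i, π i : ℕ) : ℝ) ^ (∑ i, π i) = M at *
  refine le_of_mul_le_mul_right ?_ hpos
  calc signMean π ^ 2 * M * M = signMean π ^ 2 * M ^ 2 := by ring
    _ ≤ _ := h4
    _ = P ^ 2 * R * (|signCoeff h π| ^ 2 * R) := by ring
    _ ≤ P ^ 2 * R * (2 ^ (∑ i, π i) * M) := by gcongr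
    _ = _ := by ring

lemma abs_signMean_le_exp_of_sorted (π : Fin 3 → ℕ) (hπ : Even (∑ i, π i)) (h01 : π 1 ≤ π 0)
    (h12 : π 2 ≤ π 1) (h1 : ∑ i, π i ≤ 20 * π 1) :
    |signMean π| ≤ ((∑ i, π i : ℕ) + 1 : ℝ) ^ 2 * Real.exp (-(π 2 : ℝ) / 10) := by
  have hw := abs_signMean_mul_le π
  obtain ⟨h, hh⟩ := hπ
  have hhalf : (∑ i, π i) / 2 = h := by omega
  rw [hhalf] at hw
  have h2 := abs_coeff_mul_prod_pow_le (signForm ^ h) (Finsupp.equivFunOnFinite.symm π)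
    (fun i => (π i : ℝ)) (fun i => Nat.cast_nonneg _)
    (((∑ i, π i : ℕ) ^ 2 - (∑ i, π i : ℕ) * π 2 / 5) ^ h) (by
      intro x hx
      rw [map_pow, norm_pow]
      refine pow_le_pow_left₀ (norm_nonneg _) ((norm_signForm_le_of_sorted x ?_ ?_ ?_).trans ?_) _
      · simpa [hx] using h01
      · simpa [hx] using h12
      · simp only [hx]; exact_mod_cast h1
      · simp [hx])
  change |signCoeff _ π| * ∏ i, (π i : ℝ) ^ π i ≤ _ at h2
  have hpos : 0 < ((∑ i, π i : ℕ) : ℝ) ^ (∑ i, π i) := natCast_self_pow_pos _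
  have h2N : π 2 ≤ ∑ i, π i := Finset.single_le_sum (f := π) (fun _ _ => Nat.zero_le _) (Finset.mem_univ _)
  have hexp : (((∑ i, π i : ℕ) : ℝ) ^ 2 - (∑ i, π i : ℕ) * π 2 / 5) ^ h ≤
      ((∑ i, π i : ℕ) : ℝ) ^ (∑ i, π i) * Real.exp (-(π 2 : ℝ) / 10) := by
    generalize (∑ i, π i) = N at *
    rcases Nat.eq_zero_or_pos N with rfl | hN
    · have : h = 0 := by omega
      have h0 : π 2 = 0 := by omega
      simp [this, h0]
    have hN' : (0 : ℝ) < N := by exact_mod_cast hN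
    have h2N' : (π 2 : ℝ) ≤ N := by exact_mod_cast h2N
    have e1 : (N : ℝ) ^ 2 - N * π 2 / 5 ≤ N ^ 2 * Real.exp (-(π 2 : ℝ) / (5 * N)) := by
      have := Real.add_one_le_exp (-(π 2 : ℝ) / (5 * N))
      calc (N : ℝ) ^ 2 - N * π 2 / 5 = N ^ 2 * (-(π 2 : ℝ) / (5 * N) + 1) := by field_simp; ring
        _ ≤ _ := by gcongr
    refine (pow_le_pow_left₀ (by nlinarith) e1 h).trans (le_of_eq ?_)
    rw [mul_pow, ← pow_mul, ← Real.exp_nat_mul]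
    congr 2
    · omega
    · have : (N : ℝ) = 2 * h := by exact_mod_cast (by omega : N = 2 * h)
      rw [this]
      have : (h : ℝ) ≠ 0 := by rintro h0; rw [h0] at this; linarith
      field_simp; ring
  refine le_of_mul_le_mul_right ?_ hpos
  refine hw.trans ?_
  rw [mul_assoc]
  refine mul_le_mul_of_nonneg_left ?_ (by positivity)
  rw [mul_comm]
  exact h2.trans (hexp.trans_eq (mul_comm _ _))

/-- `signMean` is exponentially small in the smallest part, if the two largest parts are comparable
with the sum. -/
lemma abs_signMean_le_exp (π : Fin 3 → ℕ) (hπ : Even (∑ i, π i)) {i j : Fin 3} (hij : i ≠ j)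
    (hi : ∑ i, π i ≤ 20 * π i) (hj : ∑ i, π i ≤ 20 * π j) {m : ℝ} (hm : ∀ i, m ≤ π i) :
    |signMean π| ≤ ((∑ i, π i : ℕ) + 1 : ℝ) ^ 2 * Real.exp (-m / 10) := by
  set τ : Equiv.Perm (Fin 3) := Fin.revPerm.trans (Tuple.sort π) with hτ
  have hanti : ∀ a b : Fin 3, a ≤ b → π (τ b) ≤ π (τ a) := fun a b hab =>
    Tuple.monotone_sort π (Fin.rev_le_rev.2 hab)
  have hs : ∑ i, (π ∘ τ) i = ∑ i, π i := Equiv.sum_comp τ π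
  rw [← signMean_comp π τ]
  have h1 : ∑ i, (π ∘ τ) i ≤ 20 * (π ∘ τ) 1 := by
    rw [hs]
    have : 1 ≤ τ.symm i ∨ 1 ≤ τ.symm j := by
      have hne : τ.symm i ≠ τ.symm j := fun h => hij (τ.symm.injective h)
      omega
    rcases this with h | h
    · have := hanti _ _ h; simp at this; simp; omega
    · have := hanti _ _ h; simp at this; simp; omega
  have := abs_signMean_le_exp_of_sorted (π ∘ τ) (by rwa [hs]) (hanti 0 1 (by decide))
    (hanti 1 2 (by decide)) h1
  rw [hs] at this
  refine this.trans ?_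
  gcongr
  exact hm _

lemma integral_exp_int (k : ℤ) :
    ∫ t in Set.Icc (0 : ℝ) (2 * Real.pi), Complex.exp (-Complex.I * (t : ℂ) * k) =
      if k = 0 then ((2 * Real.pi : ℝ) : ℂ) else 0 := by
  rw [integral_Icc_eq_integral_Ioc, ← intervalIntegral.integral_of_le (by positivity)]
  split_ifs with h
  · simp [h]
  · have hk : (-Complex.I * k : ℂ) ≠ 0 := by simp [h]
    have e : ∀ t : ℝ, Complex.exp (-Complex.I * (t : ℂ) * k) = Complex.exp (-Complex.I * k * t) := by
      intro t; ring_nf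
    simp_rw [e]
    rw [integral_exp_mul_complex hk]
    have h1 : Complex.exp (-Complex.I * k * ((2 * Real.pi : ℝ) : ℂ)) = 1 :=
      Complex.exp_eq_one_iff.2 ⟨-k, by push_cast; ring⟩
    rw [h1]
    simp

lemma integral_prod_exp_int {n : ℕ} (k : Fin n → ℤ) :
    ∫ θ in Set.univ.pi (fun _ : Fin n => Set.Icc (0 : ℝ) (2 * Real.pi)),
      ∏ j, Complex.exp (-Complex.I * (θ j : ℂ) * k j) =
      if ∀ j, k j = 0 then ((2 * Real.pi : ℝ) : ℂ) ^ n else 0 := by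
  rw [volume_pi, Measure.restrict_pi_pi,
    integral_fintype_prod_eq_prod (fun j (t : ℝ) => Complex.exp (-Complex.I * (t : ℂ) * k j))]
  simp_rw [integral_exp_int]
  split_ifs with h
  · simp [h]
  · push Not at h
    obtain ⟨j, hj⟩ := h
    exact Finset.prod_eq_zero (Finset.mem_univ j) (if_neg hj)

/-- The sign `(-1)^b` of a bit. -/
def bitSign (b : Bool) : ℤ := (-1) ^ (if b then 1 else 0)

/-- The frequency of a single angle in the expansion of the squared output probability. -/
def frequency (v : Fin 4 → Bool) : ℤ := ∑ a, ![1, -1, 1, -1] a * bitSign (v a)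

/-- The four-bit words of zero frequency, encoded by a type in `Fin 3` and a bit. -/
def zeroWord (c : Fin 3 × Bool) (a : Fin 4) : Bool :=
  xor c.2 (![![false, false, true, true], ![false, true, true, false],
    ![false, false, false, false]] c.1 a)

lemma zeroWord_injective : Function.Injective zeroWord := by
  intro c c' h
  have h := congrFun h
  revert c c'
  unfold zeroWord
  decide

lemma frequency_eq_zero_iff (v : Fin 4 → Bool) : frequency v = 0 ↔ ∃ c, zeroWord c = v := by
  constructor
  · intro h
    have : ∃ c, ∀ a, zeroWord c a = v a := by
      revert v
      unfold frequency zeroWord bitSign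
      decide
    obtain ⟨c, hc⟩ := this
    exact ⟨c, funext hc⟩
  · rintro ⟨c, rfl⟩
    revert c
    unfold frequency zeroWord bitSign
    decide

/-- The coefficient of the basis state `z` in the amplitude at the outcome `x`. -/
def gsCoeff (n : ℕ) (m : Fin n → Fin n → ℕ) (x z : Fin n → Bool) : ℝ :=
  (-1) ^ ((∑ i : Fin n, ∑ j : Fin n, if i < j ∧ z i ∧ z j then m i j else 0) +
        ∑ i : Fin n, (if x i ∧ z i then 1 else 0))

lemma gsAmp_eq (n : ℕ) (m : Fin n → Fin n → ℕ) (θ : Fin n → ℝ) (x : Fin n → Bool) :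
    gsAmp n m θ x = (1 / 2 ^ n : ℂ) * ∑ z, (gsCoeff n m x z : ℂ) *
      ∏ j, Complex.exp (-Complex.I * (θ j : ℂ) * (1 * bitSign (z j) : ℤ)) := by
  unfold gsAmp gsCoeff bitSign
  congr 1
  refine Finset.sum_congr rfl fun z _ => ?_
  push_cast
  simp

lemma conj_gsAmp_eq (n : ℕ) (m : Fin n → Fin n → ℕ) (θ : Fin n → ℝ) (x : Fin n → Bool) :
    (starRingEnd ℂ) (gsAmp n m θ x) = (1 / 2 ^ n : ℂ) * ∑ z, (gsCoeff n m x z : ℂ) *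
      ∏ j, Complex.exp (-Complex.I * (θ j : ℂ) * ((-1) * bitSign (z j) : ℤ)) := by
  rw [gsAmp_eq]
  simp only [map_mul, map_sum, map_prod, ← Complex.exp_conj, Complex.conj_ofReal, map_neg,
    Complex.conj_I, map_div₀, map_one, map_pow, map_ofNat, map_intCast]
  congr 1
  refine Finset.sum_congr rfl fun z _ => ?_
  congr 1
  refine Finset.prod_congr rfl fun j _ => ?_
  push_cast
  ring_nf

lemma gsProb_sq_eq (n : ℕ) (m : Fin n → Fin n → ℕ) (θ : Fin n → ℝ) (x : Fin n → Bool) :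
    ((gsProb n m θ x ^ 2 : ℝ) : ℂ) = (1 / 2 ^ n : ℂ) ^ 4 * ∑ Z : Fin 4 → Fin n → Bool,
      ((∏ a, gsCoeff n m x (Z a) : ℝ) : ℂ) *
      ∏ j, Complex.exp (-Complex.I * (θ j : ℂ) * frequency fun a => Z a j) := by
  have h : ((gsProb n m θ x ^ 2 : ℝ) : ℂ) = ∏ a : Fin 4, ((1 / 2 ^ n : ℂ) *
      ∑ z, (gsCoeff n m x z : ℂ) *
        ∏ j, Complex.exp (-Complex.I * (θ j : ℂ) * (![1, -1, 1, -1] a * bitSign (z j) : ℤ))) := by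
    rw [Fin.prod_univ_four]
    change _ = _ * ((1 / 2 ^ n : ℂ) * ∑ z, (gsCoeff n m x z : ℂ) *
      ∏ j, Complex.exp (-Complex.I * (θ j : ℂ) * ((-1) * bitSign (z j) : ℤ))) * _ *
      ((1 / 2 ^ n : ℂ) * ∑ z, (gsCoeff n m x z : ℂ) *
      ∏ j, Complex.exp (-Complex.I * (θ j : ℂ) * ((-1) * bitSign (z j) : ℤ)))
    rw [← conj_gsAmp_eq]
    change _ = ((1 / 2 ^ n : ℂ) * ∑ z, (gsCoeff n m x z : ℂ) *
      ∏ j, Complex.exp (-Complex.I * (θ j : ℂ) * (1 * bitSign (z j) : ℤ))) * _ *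
      ((1 / 2 ^ n : ℂ) * ∑ z, (gsCoeff n m x z : ℂ) *
      ∏ j, Complex.exp (-Complex.I * (θ j : ℂ) * (1 * bitSign (z j) : ℤ))) * _
    rw [← gsAmp_eq]
    simp only [gsProb, Complex.ofReal_pow, Complex.normSq_eq_conj_mul_self]
    ring
  rw [h, Finset.prod_mul_distrib, Finset.prod_univ_sum, Fintype.piFinset_univ]
  simp only [Finset.prod_const, Finset.card_univ, Fintype.card_fin]
  congr 1
  refine Finset.sum_congr rfl fun Z _ => ?_
  rw [Finset.prod_mul_distrib, Finset.prod_comm]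
  push_cast
  congr 1
  refine Finset.prod_congr rfl fun j _ => ?_
  rw [← Complex.exp_sum, ← Finset.mul_sum]
  congr 2
  unfold frequency
  push_cast
  rfl

lemma prod_gsCoeff_zeroWord (n : ℕ) (m : Fin n → Fin n → ℕ) (x : Fin n → Bool)
    (g : Fin n → Fin 3 × Bool) :
    ∏ a, gsCoeff n m x (fun j => zeroWord (g j) a) = (-1) ^ (∑ i, ∑ j,
      if i < j ∧ ((g i).1 = 0 ∧ (g j).1 = 1 ∨ (g i).1 = 1 ∧ (g j).1 = 0) then m i j else 0) := by
  unfold gsCoeff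
  simp_rw [pow_add, Finset.prod_mul_distrib, ← Finset.prod_pow_eq_pow_sum]
  have h1 : ∏ a : Fin 4, ∏ i, (-1 : ℝ) ^ (if x i ∧ zeroWord (g i) a then 1 else 0) = 1 := by
    rw [Finset.prod_comm]
    refine Finset.prod_eq_one fun i _ => ?_
    cases x i
    · simp
    · have : ∀ c : Fin 3 × Bool,
          ∏ a : Fin 4, (-1 : ℤ) ^ (if (true = true) ∧ zeroWord c a = true then 1 else 0) = 1 := by
        unfold zeroWord; decide
      exact_mod_cast this (g i)
  rw [h1, mul_one, Finset.prod_comm]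
  refine Finset.prod_congr rfl fun i _ => ?_
  rw [Finset.prod_comm]
  refine Finset.prod_congr rfl fun j _ => ?_
  by_cases hij : i < j
  · simp only [hij, true_and]
    have : ∀ c c' : Fin 3 × Bool,
        ∏ a : Fin 4, (-1 : ℤ) ^ (if zeroWord c a = true ∧ zeroWord c' a = true then 1 else 0) =
          (-1) ^ (if c.1 = 0 ∧ c'.1 = 1 ∨ c.1 = 1 ∧ c'.1 = 0 then 1 else 0) := by
      unfold zeroWord; decide
    have h2 := congrArg (· ^ m i j) (this (g i) (g j))
    simp only [← Finset.prod_pow, ← pow_mul, ite_mul, one_mul, zero_mul] at h2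
    exact_mod_cast h2
  · simp [hij]

lemma sum_arrow_prod_bool {n : ℕ} (F : (Fin n → Fin 3) → ℝ) :
    ∑ g : Fin n → Fin 3 × Bool, F (fun i => (g i).1) = 2 ^ n * ∑ f, F f := by
  rw [Fintype.sum_equiv (Equiv.arrowProdEquivProdArrow (Fin n) (fun _ => Fin 3) (fun _ => Bool))
    (fun g : Fin n → Fin 3 × Bool => F fun i => (g i).1)
    (fun p : (Fin n → Fin 3) × (Fin n → Bool) => F p.1) (fun _ => rfl), Fintype.sum_prod_type,
    Finset.mul_sum]
  simp

/-- The average of the second moment over the angles is a sum over three-colourings. -/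
lemma avgSecondMoment_eq (n : ℕ) (m : Fin n → Fin n → ℕ) :
    avgSecondMoment n m = (2 ^ n : ℝ)⁻¹ * ∑ f : Fin n → Fin 3, (-1) ^ (∑ i, ∑ j,
      if i < j ∧ (f i = 0 ∧ f j = 1 ∨ f i = 1 ∧ f j = 0) then m i j else 0) := by
  have hintegrable : ∀ (c : ℂ) (k : Fin n → ℤ), IntegrableOn
      (fun θ : Fin n → ℝ => c * ∏ j, Complex.exp (-Complex.I * (θ j : ℂ) * k j))
      (Set.univ.pi (fun _ : Fin n => Set.Icc (0 : ℝ) (2 * Real.pi))) := fun c k =>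
    ContinuousOn.integrableOn_compact (isCompact_univ_pi fun _ => isCompact_Icc)
      (by fun_prop)
  have key : ((∫ θ in Set.univ.pi (fun _ : Fin n => Set.Icc (0 : ℝ) (2 * Real.pi)),
      secondMoment n m θ : ℝ) : ℂ) = ((2 ^ n * (2 ^ n * ((1 / 2 ^ n) ^ 4 *
      ∑ g : Fin n → Fin 3 × Bool, (-1 : ℝ) ^ (∑ i, ∑ j,
      if i < j ∧ ((g i).1 = 0 ∧ (g j).1 = 1 ∨ (g i).1 = 1 ∧ (g j).1 = 0) then m i j else 0) *
      (2 * Real.pi) ^ n)) : ℝ) : ℂ) := by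
    rw [← integral_complex_ofReal]
    simp only [secondMoment, Complex.ofReal_mul, Complex.ofReal_sum, gsProb_sq_eq]
    rw [integral_const_mul, integral_finsetSum]
    swap
    · intro x _
      exact (integrable_finsetSum _ fun Z _ => hintegrable _ _).const_mul _
    push_cast
    congr 1
    have hx : ∀ x : Fin n → Bool, ∫ θ in Set.univ.pi (fun _ : Fin n => Set.Icc (0 : ℝ) (2 * Real.pi)),
        (1 / 2 ^ n : ℂ) ^ 4 * ∑ Z : Fin 4 → Fin n → Bool,
          (∏ a, (gsCoeff n m x (Z a) : ℂ)) *
          ∏ j, Complex.exp (-Complex.I * (θ j : ℂ) * frequency fun a => Z a j) =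
        (1 / 2 ^ n) ^ 4 *
      ∑ g : Fin n → Fin 3 × Bool, (-1 : ℂ) ^ (∑ i, ∑ j,
      if i < j ∧ ((g i).1 = 0 ∧ (g j).1 = 1 ∨ (g i).1 = 1 ∧ (g j).1 = 0) then m i j else 0) *
      (2 * Real.pi) ^ n := by
      intro x
      rw [integral_const_mul, integral_finsetSum _ fun Z _ => hintegrable _ _]
      congr 1
      simp_rw [integral_const_mul, integral_prod_exp_int]
      symm
      refine Fintype.sum_of_injective (fun g a j => zeroWord (g j) a) ?_ _ _ ?_ ?_
      · intro g g' h
        funext j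
        refine zeroWord_injective (funext fun a => ?_)
        exact congrFun (congrFun h a) j
      · intro Z hZ
        rw [if_neg, mul_zero]
        intro h
        choose c hc using fun j => (frequency_eq_zero_iff _).1 (h j)
        exact hZ ⟨c, by funext a j; exact congrFun (hc j) a⟩
      · intro g
        rw [if_pos fun j => (frequency_eq_zero_iff _).2 ⟨g j, rfl⟩, ← Complex.ofReal_prod,
          prod_gsCoeff_zeroWord]
        push_cast
        rfl
    simp_rw [hx]
    simp
  have key := Complex.ofReal_injective key
  unfold avgSecondMoment
  rw [key, ← Finset.sum_mul]
  have hfst : ∑ g : Fin n → Fin 3 × Bool, (-1 : ℝ) ^ (∑ i, ∑ j,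
      if i < j ∧ ((g i).1 = 0 ∧ (g j).1 = 1 ∨ (g i).1 = 1 ∧ (g j).1 = 0) then m i j else 0) =
      2 ^ n * ∑ f : Fin n → Fin 3, (-1 : ℝ) ^ (∑ i, ∑ j,
      if i < j ∧ (f i = 0 ∧ f j = 1 ∨ f i = 1 ∧ f j = 0) then m i j else 0) :=
    sum_arrow_prod_bool fun f => (-1 : ℝ) ^ (∑ i, ∑ j,
      if i < j ∧ (f i = 0 ∧ f j = 1 ∨ f i = 1 ∧ f j = 0) then m i j else 0)
  rw [hfst]
  have hpi : (2 * Real.pi) ^ n ≠ 0 := by positivity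
  field_simp

/-- The number of points of each colour. -/
def colorCount {V : Type*} [Fintype V] (F : V → Fin 3) (i : Fin 3) : ℕ :=
  (Finset.univ.filter fun v => F v = i).card

lemma sum_colorCount {V : Type*} [Fintype V] (F : V → Fin 3) :
    ∑ i, colorCount F i = Fintype.card V := by
  unfold colorCount
  exact (Finset.card_eq_sum_card_fiberwise (f := F) (t := Finset.univ) (by simp)).symm

lemma colorCount_comp_equiv {V W : Type*} [Fintype V] [Fintype W] (F : V → Fin 3) (e : W ≃ V) :
    colorCount (F ∘ e) = colorCount F := by
  funext i
  unfold colorCount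
  exact Finset.card_bijective e e.bijective (by simp)

lemma colorCount_comp_fst {n d : ℕ} (f : Fin n → Fin 3) (i : Fin 3) :
    colorCount (fun v : Fin n × Fin d => f v.1) i = d * colorCount f i := by
  unfold colorCount
  have : (Finset.univ.filter fun v : Fin n × Fin d => f v.1 = i) =
      (Finset.univ.filter fun v => f v = i) ×ˢ Finset.univ := by
    ext v; simp
  rw [this, Finset.card_product, Finset.card_univ, Fintype.card_fin, mul_comm]

/-- The sign of the colouring `F` with respect to the matching `σ`: each pair with colours
`0` and `1` contributes `-1`. -/
def matchSign {V : Type*} [Fintype V] (σ : Equiv.Perm V) (F : V → Fin 3) : ℝ :=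
  (-1) ^ (Finset.univ.filter fun v => F v = 0 ∧ F (σ v) = 1).card

lemma matchSign_eq_of_conj {V W : Type*} [Fintype V] [Fintype W] (σ : Equiv.Perm V)
    (σ' : Equiv.Perm W) (e : W ≃ V) (he : ∀ w, σ (e w) = e (σ' w)) (F : V → Fin 3) :
    matchSign σ F = matchSign σ' (F ∘ e) := by
  unfold matchSign
  congr 1
  symm
  exact Finset.card_bijective e e.bijective (by simp [he])

lemma sum_pairingMult_eq {n d : ℕ} {σ : Equiv.Perm (Fin n × Fin d)}
    (hσ : ∀ v, σ (σ v) = v) (f : Fin n → Fin 3) :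
    (∑ i, ∑ j, if i < j ∧ (f i = 0 ∧ f j = 1 ∨ f i = 1 ∧ f j = 0) then pairingMult n d σ i j else 0) =
      (Finset.univ.filter fun v : Fin n × Fin d => f v.1 = 0 ∧ f (σ v).1 = 1).card := by
  have h1 : (∑ i, ∑ j, if i < j ∧ (f i = 0 ∧ f j = 1 ∨ f i = 1 ∧ f j = 0) then
      pairingMult n d σ i j else 0) = ∑ v : Fin n × Fin d, if v.1 < (σ v).1 ∧
        (f v.1 = 0 ∧ f (σ v).1 = 1 ∨ f v.1 = 1 ∧ f (σ v).1 = 0) then 1 else 0 := by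
    rw [Fintype.sum_prod_type]
    refine Finset.sum_congr rfl fun i _ => ?_
    have : ∀ k : Fin d, (if i < (σ (i, k)).1 ∧
        (f i = 0 ∧ f (σ (i, k)).1 = 1 ∨ f i = 1 ∧ f (σ (i, k)).1 = 0) then 1 else 0) =
        ∑ j, if i < j ∧ (f i = 0 ∧ f j = 1 ∨ f i = 1 ∧ f j = 0) then
          (if (σ (i, k)).1 = j then 1 else 0) else 0 := by
      intro k
      rw [Finset.sum_eq_single (σ (i, k)).1]
      · simp
      · intro j _ hj
        simp [hj.symm]
      · simp
    simp_rw [this]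
    rw [Finset.sum_comm]
    refine Finset.sum_congr rfl fun j _ => ?_
    split_ifs
    · simp [pairingMult]
    · simp
  have h2 : ∀ v : Fin n × Fin d, (if v.1 < (σ v).1 ∧
        (f v.1 = 0 ∧ f (σ v).1 = 1 ∨ f v.1 = 1 ∧ f (σ v).1 = 0) then 1 else 0) =
      (if v.1 < (σ v).1 ∧ f v.1 = 0 ∧ f (σ v).1 = 1 then 1 else 0) +
      (if v.1 < (σ v).1 ∧ f v.1 = 1 ∧ f (σ v).1 = 0 then 1 else 0) := by
    intro v
    generalize f v.1 = a
    generalize f (σ v).1 = b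
    by_cases h : v.1 < (σ v).1
    · simp only [h, true_and]; revert a b; decide
    · simp [h]
  rw [h1, Finset.sum_congr rfl fun v _ => h2 v, Finset.sum_add_distrib,
    ← Equiv.sum_comp σ (fun v => if v.1 < (σ v).1 ∧ f v.1 = 1 ∧ f (σ v).1 = 0 then 1 else 0),
    ← Finset.sum_add_distrib, Finset.card_filter]
  refine Finset.sum_congr rfl fun v _ => ?_
  rw [hσ]
  by_cases h0 : f v.1 = 0
  · by_cases h1 : f (σ v).1 = 1
    · have hne : v.1 ≠ (σ v).1 := by
        intro h; rw [h, h1] at h0; exact absurd h0 (by decide)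
      rcases lt_or_gt_of_ne hne with h | h
      · simp [h0, h1, h, not_lt.2 h.le]
      · simp [h0, h1, h, not_lt.2 h.le]
    · simp [h0, h1]
  · simp [h0]

/-- The standard perfect matching of `Fin h × Bool`. -/
def stdMatching (h : ℕ) : Equiv.Perm (Fin h × Bool) := (Equiv.refl _).prodCongr Equiv.boolNot

lemma mem_perfectMatchings {V : Type*} [Fintype V] [DecidableEq V] {σ : Equiv.Perm V} :
    σ ∈ perfectMatchings V ↔ (∀ v, σ (σ v) = v) ∧ ∀ v, σ v ≠ v := by
  simp [perfectMatchings]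

lemma cycleType_eq_of_mem_perfectMatchings {V : Type*} [Fintype V] [DecidableEq V]
    {σ : Equiv.Perm V} (hσ : σ ∈ perfectMatchings V) :
    σ.cycleType = Multiset.replicate (Fintype.card V / 2) 2 := by
  rw [mem_perfectMatchings] at hσ
  rcases isEmpty_or_nonempty V with hV | ⟨⟨v⟩⟩
  · have : σ = 1 := Subsingleton.elim _ _
    simp [this]
  have ho : orderOf σ = 2 := by
    refine orderOf_eq_prime (p := 2) ?_ ?_
    · ext v; simp [pow_two, hσ.1]
    · rintro rfl; exact hσ.2 v rfl
  obtain ⟨k, hk⟩ := Equiv.Perm.cycleType_prime_order (σ := σ) (by rw [ho]; exact Nat.prime_two)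
  have hs : σ.support = Finset.univ := by ext v; simp [hσ.2 v]
  have hsum := σ.sum_cycleType
  rw [hk, hs, Finset.card_univ, ho, Multiset.sum_replicate, smul_eq_mul] at hsum
  rw [hk, ho, ← hsum, Nat.mul_div_cancel _ two_pos]

lemma permCongr_stdMatching_mem {V : Type*} [Fintype V] [DecidableEq V] {h : ℕ}
    (e : Fin h × Bool ≃ V) : e.permCongr (stdMatching h) ∈ perfectMatchings V := by
  rw [mem_perfectMatchings]
  constructor
  · intro v
    have hs : ∀ w, stdMatching h (stdMatching h w) = w := fun w => by
      simp [stdMatching, Prod.map]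
    simp [Equiv.permCongr_apply, hs]
  · intro v hv
    rw [Equiv.permCongr_apply, ← Equiv.eq_symm_apply] at hv
    have := congrArg Prod.snd hv
    simp [stdMatching] at this

lemma exists_equiv_stdMatching {V : Type*} [Fintype V] [DecidableEq V] {h : ℕ}
    (hV : Fintype.card V = 2 * h) {σ : Equiv.Perm V} (hσ : σ ∈ perfectMatchings V) :
    ∃ e : Fin h × Bool ≃ V, ∀ w, σ (e w) = e (stdMatching h w) := by
  obtain ⟨e₀⟩ : Nonempty (Fin h × Bool ≃ V) := Fintype.card_eq.1 (by simp [hV, mul_comm])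
  have hc : IsConj (e₀.permCongr (stdMatching h)) σ := by
    rw [Equiv.Perm.isConj_iff_cycleType_eq,
      cycleType_eq_of_mem_perfectMatchings (permCongr_stdMatching_mem e₀),
      cycleType_eq_of_mem_perfectMatchings hσ]
  obtain ⟨c, hc⟩ := isConj_iff.1 hc
  refine ⟨e₀.trans c, fun w => ?_⟩
  rw [← hc]
  simp [Equiv.permCongr_apply]

lemma card_perm_comp_eq {W : Type*} [Fintype W] [DecidableEq W] (F G : W → Fin 3)
    (h : colorCount F = colorCount G) :
    (Finset.univ.filter fun τ : Equiv.Perm W => F ∘ τ = G).card =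
      ∏ i, (colorCount F i).factorial := by
  have hne : ∀ c, Nonempty ({w // G w = c} ≃ {w // F w = c}) := fun c => by
    refine Fintype.card_eq.1 ?_
    rw [Fintype.card_subtype, Fintype.card_subtype]
    exact (congrFun h c).symm
  set τ₀ : Equiv.Perm W := Equiv.ofFiberEquiv fun c => (hne c).some with hτ₀
  have h₀ : ∀ w, F (τ₀ w) = G w := fun w => Equiv.ofFiberEquiv_map _ w
  have hs := DomMulAct.stabilizer_card F
  simp only [Fintype.card_subtype] at hs
  unfold colorCount
  rw [← hs]
  refine Finset.card_bijective (fun τ => τ * τ₀⁻¹) (Group.mulRight_bijective _) ?_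
  intro τ
  simp only [Finset.mem_filter, Finset.mem_univ, true_and]
  constructor
  · intro hτ
    funext w
    have := congrFun hτ (τ₀⁻¹ w)
    simp only [Function.comp_apply] at this ⊢
    rw [Equiv.Perm.mul_apply, this, ← h₀]
    simp
  · intro hτ
    funext w
    have := congrFun hτ (τ₀ w)
    simpa [h₀] using this

lemma signForm_eq_sum : signForm = ∑ p : Bool → Fin 3,
    MvPolynomial.C (if p false = p true then 1 else -1) * ∏ b, MvPolynomial.X (p b) := by
  rw [Fintype.sum_equiv (Equiv.boolArrowEquivProd (Fin 3)) (fun p : Bool → Fin 3 =>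
    (MvPolynomial.C (if p false = p true then 1 else -1) * ∏ b, MvPolynomial.X (p b) :
      MvPolynomial (Fin 3) ℝ)) (fun p : Fin 3 × Fin 3 =>
    MvPolynomial.C (if p.1 = p.2 then 1 else -1) * (MvPolynomial.X p.1 * MvPolynomial.X p.2))
    (fun p => by
      simp only [Equiv.boolArrowEquivProd, Equiv.coe_fn_mk, Fintype.prod_bool]
      rw [mul_comm (MvPolynomial.X (p true))]
      congr)]
  rw [Fintype.sum_prod_type]
  simp [Fin.sum_univ_three, signForm]
  ring

lemma signCoeff_eq_sum (h : ℕ) (π : Fin 3 → ℕ) :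
    signCoeff h π = ∑ G : Fin h × Bool → Fin 3, if colorCount G = π then
      ∏ k, (if G (k, false) = G (k, true) then (1 : ℝ) else -1) else 0 := by
  have hpow : signForm ^ h = ∑ G : Fin h × Bool → Fin 3,
      MvPolynomial.monomial (Finsupp.equivFunOnFinite.symm (colorCount G))
        (∏ k, (if G (k, false) = G (k, true) then (1 : ℝ) else -1)) := by
    have h1 : signForm ^ h = ∏ _k : Fin h, signForm := by simp
    rw [h1]
    conv_lhs => enter [2, k]; rw [signForm_eq_sum]
    rw [Finset.prod_univ_sum, Fintype.piFinset_univ]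
    symm
    refine Fintype.sum_equiv (Equiv.curry _ _ _) _ _ fun G => ?_
    simp only [Equiv.curry_apply, Function.curry_apply]
    rw [Finset.prod_mul_distrib, ← map_prod]
    have h2 : ∏ k : Fin h, ∏ b : Bool, (MvPolynomial.X (G (k, b)) : MvPolynomial (Fin 3) ℝ) =
        MvPolynomial.monomial (Finsupp.equivFunOnFinite.symm (colorCount G)) 1 := by
      rw [← Fintype.prod_prod_type' (f := fun k b => (MvPolynomial.X (G (k, b)) : MvPolynomial (Fin 3) ℝ))]
      unfold MvPolynomial.X
      rw [← MvPolynomial.monomial_sum_one]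
      refine congrArg (fun m => MvPolynomial.monomial m (1 : ℝ)) (Finsupp.ext fun i => ?_)
      simp [colorCount, Finsupp.single_apply]
    rw [h2, MvPolynomial.C_mul_monomial, mul_one]
  unfold signCoeff
  rw [hpow, MvPolynomial.coeff_sum]
  refine Finset.sum_congr rfl fun G _ => ?_
  rw [MvPolynomial.coeff_monomial]
  simp only [EmbeddingLike.apply_eq_iff_eq]

lemma matchSign_stdMatching {h : ℕ} (G : Fin h × Bool → Fin 3) :
    matchSign (stdMatching h) G = (-1) ^ colorCount G 2 *
      ∏ k, (if G (k, false) = G (k, true) then (1 : ℝ) else -1) := by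
  unfold matchSign colorCount
  rw [Finset.card_filter, Finset.card_filter, ← Finset.prod_pow_eq_pow_sum,
    ← Finset.prod_pow_eq_pow_sum, Fintype.prod_prod_type, Fintype.prod_prod_type,
    ← Finset.prod_mul_distrib]
  refine Finset.prod_congr rfl fun k _ => ?_
  simp only [Fintype.prod_bool, stdMatching, Equiv.prodCongr_apply, Prod.map, Equiv.refl_apply,
    Equiv.boolNot_apply, Bool.not_true, Bool.not_false]
  generalize G (k, false) = a
  generalize G (k, true) = b
  have : ∀ a b : Fin 3, (-1 : ℤ) ^ (if b = 0 ∧ a = 1 then 1 else 0) *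
      (-1) ^ (if a = 0 ∧ b = 1 then 1 else 0) = (-1) ^ (if b = 2 then 1 else 0) *
      (-1) ^ (if a = 2 then 1 else 0) * if a = b then 1 else -1 := by decide
  exact_mod_cast this a b

lemma sum_perm_matchSign {h : ℕ} (F : Fin h × Bool → Fin 3) :
    ∑ τ : Equiv.Perm (Fin h × Bool), matchSign (stdMatching h) (F ∘ τ) =
      (-1) ^ colorCount F 2 * ((2 * h).factorial * signMean (colorCount F)) := by
  have hsum : ∑ i, colorCount F i = 2 * h := by rw [sum_colorCount]; simp [mul_comm]
  have h1 : ∑ τ : Equiv.Perm (Fin h × Bool), matchSign (stdMatching h) (F ∘ τ) =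
      ∑ G : Fin h × Bool → Fin 3, ∑ τ : Equiv.Perm (Fin h × Bool),
        if F ∘ τ = G then matchSign (stdMatching h) G else 0 := by
    rw [Finset.sum_comm]
    simp
  rw [h1]
  unfold signMean
  rw [hsum, Nat.mul_div_cancel_left _ two_pos, ← mul_assoc ((2 * h).factorial : ℝ),
    mul_div_cancel₀ _ (by positivity), signCoeff_eq_sum, Finset.mul_sum, Finset.mul_sum]
  refine Finset.sum_congr rfl fun G _ => ?_
  rw [← Finset.sum_filter, Finset.sum_const, nsmul_eq_mul]
  split_ifs with hG
  · rw [card_perm_comp_eq F G hG.symm, matchSign_stdMatching, hG]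
    push_cast
    ring
  · rw [Finset.card_eq_zero.2]
    · simp
    · refine Finset.filter_eq_empty_iff.2 fun τ _ hτ => hG ?_
      rw [← hτ, colorCount_comp_equiv]

lemma sum_matchSign {V : Type*} [Fintype V] [DecidableEq V] {h : ℕ}
    (hV : Fintype.card V = 2 * h) (F : V → Fin 3) :
    ∑ σ ∈ perfectMatchings V, matchSign σ F = (perfectMatchings V).card *
      ((-1) ^ colorCount F 2 * signMean (colorCount F)) := by
  have h1 : ∀ τ : Equiv.Perm V, ∑ σ ∈ perfectMatchings V, matchSign σ F =
      ∑ σ ∈ perfectMatchings V, matchSign σ (F ∘ τ) := by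
    intro τ
    refine Finset.sum_equiv (MulAut.conj τ⁻¹).toEquiv ?_ ?_
    · intro σ
      simp only [mem_perfectMatchings]
      constructor
      · rintro ⟨ha, hb⟩
        refine ⟨fun v => by simp [ha], fun v hv => hb (τ v) ?_⟩
        simpa [Equiv.symm_apply_eq] using hv
      · rintro ⟨ha, hb⟩
        refine ⟨fun v => ?_, fun v hv => hb (τ⁻¹ v) ?_⟩
        · simpa [Equiv.Perm.inv_eq_iff_eq] using ha (τ⁻¹ v)
        · simp [hv]
    · intro σ _
      exact matchSign_eq_of_conj _ _ τ (by simp) F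
  have h2 : ∀ σ ∈ perfectMatchings V, ∑ τ : Equiv.Perm V, matchSign σ (F ∘ τ) =
      (-1) ^ colorCount F 2 * ((2 * h).factorial * signMean (colorCount F)) := by
    intro σ hσ
    obtain ⟨e, he⟩ := exists_equiv_stdMatching hV hσ
    rw [← colorCount_comp_equiv F e, ← sum_perm_matchSign]
    refine Fintype.sum_equiv (e.symm.permCongr) _ _ fun τ => ?_
    rw [matchSign_eq_of_conj σ _ e he]
    congr 1
    funext w
    simp [Equiv.permCongr_apply]
  have h3 : ((2 * h).factorial : ℝ) * ∑ σ ∈ perfectMatchings V, matchSign σ F =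
      ∑ τ : Equiv.Perm V, ∑ σ ∈ perfectMatchings V, matchSign σ (F ∘ τ) := by
    rw [← Finset.sum_congr rfl fun τ _ => h1 τ, Finset.sum_const, Finset.card_univ,
      Fintype.card_perm, hV, nsmul_eq_mul]
  rw [Finset.sum_comm, Finset.sum_congr rfl h2, Finset.sum_const, nsmul_eq_mul] at h3
  have hpos : ((2 * h).factorial : ℝ) ≠ 0 := by positivity
  refine mul_left_cancel₀ hpos ?_
  rw [h3]
  ring

/-- The average second moment of the pairing model as a sum over colourings. -/
lemma pairingAvgM2_eq (n d : ℕ) (hn : Even n) :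
    pairingAvgM2 n d = (2 ^ n : ℝ)⁻¹ * ∑ f : Fin n → Fin 3,
      (-1) ^ (d * colorCount f 2) * signMean (fun i => d * colorCount f i) := by
  obtain ⟨k, hk⟩ := hn
  have hV : Fintype.card (Fin n × Fin d) = 2 * (k * d) := by
    simp [hk]; ring
  have hne : ((perfectMatchings (Fin n × Fin d)).card : ℝ) ≠ 0 := by
    obtain ⟨e₀⟩ : Nonempty (Fin (k * d) × Bool ≃ Fin n × Fin d) :=
      Fintype.card_eq.1 (by rw [hV]; simp [mul_comm])
    exact_mod_cast Finset.card_ne_zero_of_mem (permCongr_stdMatching_mem e₀)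
  unfold pairingAvgM2
  rw [div_eq_iff hne]
  have h1 : ∀ σ ∈ perfectMatchings (Fin n × Fin d), avgSecondMoment n (pairingMult n d σ) =
      (2 ^ n : ℝ)⁻¹ * ∑ f : Fin n → Fin 3, matchSign σ (fun v => f v.1) := by
    intro σ hσ
    rw [avgSecondMoment_eq]
    congr 1
    refine Finset.sum_congr rfl fun f _ => ?_
    rw [sum_pairingMult_eq (mem_perfectMatchings.1 hσ).1]
    rfl
  rw [Finset.sum_congr rfl h1, ← Finset.mul_sum, Finset.sum_comm,
    Finset.sum_congr rfl fun f _ => sum_matchSign hV fun v => f v.1, mul_assoc, Finset.sum_mul]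
  congr 1
  refine Finset.sum_congr rfl fun f _ => ?_
  rw [colorCount_comp_fst, show colorCount (fun v : Fin n × Fin d => f v.1) =
    fun i => d * colorCount f i from funext fun i => colorCount_comp_fst f i]
  ring

lemma prod_pow_colorCount {n : ℕ} (x : Fin 3 → ℝ) (f : Fin n → Fin 3) :
    ∏ i, x i ^ colorCount f i = ∏ v, x (f v) := by
  rw [← Finset.prod_fiberwise Finset.univ f]
  refine Finset.prod_congr rfl fun i _ => ?_
  rw [colorCount, ← Finset.prod_const]
  refine Finset.prod_congr rfl fun v hv => ?_
  rw [(Finset.mem_filter.1 hv).2]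

lemma sum_prod_pow_colorCount (n : ℕ) (x : Fin 3 → ℝ) :
    ∑ f : Fin n → Fin 3, ∏ i, x i ^ colorCount f i = (∑ i, x i) ^ n := by
  simp_rw [prod_pow_colorCount]
  have := Finset.prod_univ_sum (fun _ : Fin n => (Finset.univ : Finset (Fin 3))) (fun _ i => x i)
  rw [Fintype.piFinset_univ] at this
  rw [← this]
  simp

lemma sum_colorCount_fin {n : ℕ} (f : Fin n → Fin 3) : ∑ i, colorCount f i = n := by
  rw [sum_colorCount, Fintype.card_fin]

lemma even_sum_mul_colorCount {n : ℕ} (d : ℕ) (hn : Even n) (f : Fin n → Fin 3) :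
    Even (∑ i, d * colorCount f i) := by
  rw [← Finset.mul_sum, sum_colorCount_fin]
  exact hn.mul_left d

/-- Outside the colourings using all colours, the summand of `pairingAvgM2` is explicit. -/
lemma abs_summand_sub_le {n d : ℕ} (hn : Even n) (f : Fin n → Fin 3) :
    |(-1) ^ (d * colorCount f 2) * signMean (fun i => d * colorCount f i) -
      (0 ^ colorCount f 0 + 0 ^ colorCount f 1 + 0 ^ colorCount f 2 * ((-1) ^ d) ^ colorCount f 1)| ≤
      (if ∀ i, 0 < colorCount f i then |signMean fun i => d * colorCount f i| else 0) +
      3 * (0 ^ colorCount f 0 * 0 ^ colorCount f 1 + 0 ^ colorCount f 0 * 0 ^ colorCount f 2 +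
        0 ^ colorCount f 1 * 0 ^ colorCount f 2) := by
  have hs := sum_colorCount_fin f
  have he := even_sum_mul_colorCount d hn f
  have hv : (fun i => d * colorCount f i) =
      ![d * colorCount f 0, d * colorCount f 1, d * colorCount f 2] := by
    funext i; fin_cases i <;> rfl
  have hle := abs_signMean_le_one _ he
  rw [hv] at hle ⊢
  rw [Fin.sum_univ_three] at hs he
  simp only [Fin.forall_fin_succ, Fin.succ_zero_eq_one, Fin.succ_one_eq_two, IsEmpty.forall_iff,
    and_true]
  generalize colorCount f 0 = a at *
  generalize colorCount f 1 = b at *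
  generalize colorCount f 2 = c at *
  have hval : ∀ k : ℕ, |(-1 : ℝ) ^ k * signMean ![d * a, d * b, d * c]| ≤ 1 := by
    intro k; rw [abs_mul]; simpa using hle
  have hsq : ∀ k : ℕ, (-1 : ℝ) ^ k * (-1) ^ k = 1 := by intro k; rw [← mul_pow]; simp
  rcases Nat.eq_zero_or_pos a with rfl | ha <;> rcases Nat.eq_zero_or_pos b with rfl | hb <;>
    rcases Nat.eq_zero_or_pos c with rfl | hc
  · have := abs_le.1 (hval (d * 0)); simp at this ⊢; rw [abs_le]; constructor <;> linarith
  · have := abs_le.1 (hval (d * c)); simp [hc.ne'] at this ⊢; rw [abs_le]; constructor <;> linarith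
  · have h1 := abs_le.1 (hval (d * 0))
    have h2 := abs_le.1 (show |((-1 : ℝ) ^ d) ^ b| ≤ 1 by simp)
    simp [hb.ne'] at h1 h2 ⊢; rw [abs_le]; constructor <;> linarith
  · rw [show d * 0 = 0 by simp, signMean_zero_left _ _ (by simpa using he), hsq]
    simp [hb.ne', hc.ne']
  · have := abs_le.1 (hval (d * 0)); simp [ha.ne'] at this ⊢; rw [abs_le]; constructor <;> linarith
  · rw [show d * 0 = 0 by simp, signMean_swap01, signMean_zero_left _ _ (by simpa using he), hsq]
    simp [ha.ne', hc.ne']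
  · rw [show d * 0 = 0 by simp, signMean_swap02,
      signMean_zero_left _ _ (by simpa [add_comm] using he)]
    have : (-1 : ℝ) ^ (d * a) = ((-1) ^ d) ^ b := by
      rw [← pow_mul, neg_one_pow_eq_pow_mod_two, neg_one_pow_eq_pow_mod_two (d * b)]
      congr 1
      have : (d * a + d * b) % 2 = 0 := Nat.even_iff.1 (by simpa using he)
      omega
    simp [ha.ne', hb.ne', this]
  · simp [ha.ne', hb.ne', hc.ne', ha, hb, hc]

/-- The contribution to the average second moment of colourings using all colours. -/
def properPart (n d : ℕ) : ℝ := (2 ^ n : ℝ)⁻¹ * ∑ f : Fin n → Fin 3,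
  if ∀ i, 0 < colorCount f i then |signMean fun i => d * colorCount f i| else 0

lemma abs_pairingAvgM2_sub_le {n : ℕ} (d : ℕ) (hn : Even n) :
    |pairingAvgM2 n d - (2 + ((1 + (-1) ^ d) / 2) ^ n)| ≤ properPart n d + 9 * (2 ^ n : ℝ)⁻¹ := by
  have h2 : (0 : ℝ) < 2 ^ n := by positivity
  have s0 := sum_prod_pow_colorCount n ![0, 1, 1]
  have s1 := sum_prod_pow_colorCount n ![1, 0, 1]
  have s2 := sum_prod_pow_colorCount n ![1, (-1) ^ d, 0]
  have t0 := sum_prod_pow_colorCount n ![0, 0, 1]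
  have t1 := sum_prod_pow_colorCount n ![0, 1, 0]
  have t2 := sum_prod_pow_colorCount n ![1, 0, 0]
  simp only [Fin.prod_univ_three, Fin.sum_univ_three, Matrix.cons_val_zero, Matrix.cons_val_one,
    Matrix.cons_val, one_pow, mul_one, one_mul, add_zero, zero_add, one_add_one_eq_two] at s0 s1 s2 t0 t1 t2
  have e1 : 2 + ((1 + (-1 : ℝ) ^ d) / 2) ^ n = (2 ^ n : ℝ)⁻¹ * ∑ f : Fin n → Fin 3,
      (0 ^ colorCount f 0 + 0 ^ colorCount f 1 +
        0 ^ colorCount f 2 * ((-1) ^ d) ^ colorCount f 1) := by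
    rw [Finset.sum_add_distrib, Finset.sum_add_distrib, s0, s1]
    simp_rw [mul_comm ((0 : ℝ) ^ colorCount _ 2)]
    rw [s2, div_pow]
    field_simp
    ring
  rw [e1, pairingAvgM2_eq n d hn, ← mul_sub, ← Finset.sum_sub_distrib, abs_mul,
    abs_of_pos (inv_pos.2 h2)]
  have h3 := (Finset.abs_sum_le_sum_abs _ _).trans
    (Finset.sum_le_sum fun f (_ : f ∈ Finset.univ) => abs_summand_sub_le (d := d) hn f)
  rw [Finset.sum_add_distrib, ← Finset.mul_sum, Finset.sum_add_distrib, Finset.sum_add_distrib,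
    t0, t1, t2] at h3
  refine (mul_le_mul_of_nonneg_left h3 (inv_pos.2 h2).le).trans (le_of_eq ?_)
  unfold properPart
  ring

/-- The proportion, relative to `2 ^ n`, of colourings with the given colour counts. -/
lemma card_mul_prod_le {n : ℕ} (x : Fin 3 → ℝ) (hx : ∀ i, 0 ≤ x i) (c : Fin 3 → ℕ) :
    ((Finset.univ.filter fun f : Fin n → Fin 3 => colorCount f = c).card : ℝ) * ∏ i, x i ^ c i ≤
      (∑ i, x i) ^ n := by
  rw [← sum_prod_pow_colorCount, ← nsmul_eq_mul, ← Finset.sum_const]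
  refine (Finset.sum_le_sum fun f hf => ?_).trans
    (Finset.sum_le_univ_sum_of_nonneg fun f => Finset.prod_nonneg fun i _ => pow_nonneg (hx i) _)
  rw [(Finset.mem_filter.1 hf).2]

lemma signMean_sq_mul_pow_le {n d : ℕ} (hn : Even n) (hd : 0 < d) (c : Fin 3 → ℕ) (hc : ∑ i, c i = n) :
    signMean (fun i => d * c i) ^ 2 * ((n : ℝ) ^ n / (2 ^ n * ∏ i, (c i : ℝ) ^ c i)) ^ d ≤
      (((d * n : ℕ) + 1 : ℝ) ^ 2) ^ 2 := by
  have hs : ∑ i, d * c i = d * n := by rw [← Finset.mul_sum, hc]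
  have h := signMean_sq_mul_le (fun i => d * c i) (by rw [hs]; exact hn.mul_left d)
  rw [hs] at h
  have hprod : ∏ i, ((d * c i : ℕ) : ℝ) ^ (d * c i) =
      (d : ℝ) ^ (d * n) * (∏ i, (c i : ℝ) ^ c i) ^ d := by
    rw [← hs, ← Finset.prod_pow_eq_pow_sum, ← Finset.prod_pow, ← Finset.prod_mul_distrib]
    refine Finset.prod_congr rfl fun i _ => ?_
    push_cast
    rw [mul_pow, ← pow_mul, mul_comm (c i) d]
  have hR : 0 < ∏ i, (c i : ℝ) ^ c i := Finset.prod_pos fun i _ => natCast_self_pow_pos _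
  have hdp : (0 : ℝ) < (d : ℝ) ^ (d * n) := by positivity
  rw [hprod] at h
  rw [div_pow, mul_pow, ← pow_mul, ← pow_mul, mul_comm n d, mul_div_assoc', div_le_iff₀ (by positivity)]
  refine le_of_mul_le_mul_left ?_ hdp
  calc _ = signMean (fun i => d * c i) ^ 2 * ((d * n : ℕ) : ℝ) ^ (d * n) := by
        push_cast; rw [mul_pow]; ring
    _ ≤ _ := h
    _ = _ := by ring

lemma card_mul_signMean_le_exp {n d : ℕ} (hn : Even n) (hd : 3 ≤ d) (c : Fin 3 → ℕ)
    (hc : ∑ i, c i = n) {t : ℝ} (ht : ∀ i, t ≤ c i) {i j : Fin 3} (hij : i ≠ j)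
    (hi : n ≤ 20 * c i) (hj : n ≤ 20 * c j) (ht0 : 0 ≤ t) :
    (2 ^ n : ℝ)⁻¹ * (Finset.univ.filter fun f : Fin n → Fin 3 => colorCount f = c).card *
      |signMean fun i => d * c i| ≤ ((d * n : ℕ) + 1 : ℝ) ^ 2 * Real.exp (-t / 10) := by
  have hs : ∑ i, d * c i = d * n := by rw [← Finset.mul_sum, hc]
  have heven : Even (∑ i, d * c i) := by rw [hs]; exact hn.mul_left d
  have hR : 0 < ∏ i, (c i : ℝ) ^ c i := Finset.prod_pos fun i _ => natCast_self_pow_pos _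
  have hν : (2 ^ n : ℝ)⁻¹ * (Finset.univ.filter fun f : Fin n → Fin 3 => colorCount f = c).card ≤
      (n : ℝ) ^ n / (2 ^ n * ∏ i, (c i : ℝ) ^ c i) := by
    have := card_mul_prod_le (n := n) (fun i => (c i : ℝ)) (fun i => Nat.cast_nonneg _) c
    rw [← Nat.cast_sum, hc] at this
    rw [le_div_iff₀ (by positivity)]
    calc _ = (Finset.univ.filter fun f : Fin n → Fin 3 => colorCount f = c).card *
          ∏ i, (c i : ℝ) ^ c i := by field_simp
      _ ≤ _ := this
  have hw := signMean_sq_mul_pow_le (d := d) hn (by omega) c hc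
  have hw1 := abs_signMean_le_one _ heven
  have he := abs_signMean_le_exp (fun i => d * c i) heven hij
    (by rw [hs]; nlinarith) (by rw [hs]; nlinarith) (m := d * t) (fun i => by
      push_cast; exact mul_le_mul_of_nonneg_left (ht i) (Nat.cast_nonneg _))
  rw [hs] at he
  rw [← sq_abs] at hw
  have hP : 1 ≤ ((d * n : ℕ) + 1 : ℝ) ^ 2 := one_le_pow₀ (le_add_of_nonneg_left (Nat.cast_nonneg _))
  have hν0 : 0 ≤ (2 ^ n : ℝ)⁻¹ * (Finset.univ.filter fun f : Fin n → Fin 3 => colorCount f = c).card := by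
    positivity
  have hw0 := abs_nonneg (signMean fun i => d * c i)
  generalize (2 ^ n : ℝ)⁻¹ * (Finset.univ.filter fun f : Fin n → Fin 3 => colorCount f = c).card = ν at *
  generalize (n : ℝ) ^ n / (2 ^ n * ∏ i, (c i : ℝ) ^ c i) = ϑ at *
  generalize |signMean fun i => d * c i| = w at *
  generalize ((d * n : ℕ) + 1 : ℝ) ^ 2 = P at *
  have hcube : (ν * w) ^ 3 ≤ P ^ 2 * w := by
    rcases le_total ϑ 1 with h | h
    · have h1 : ν * w ≤ w := by nlinarith
      calc (ν * w) ^ 3 ≤ w ^ 3 := by gcongr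
        _ = w ^ 2 * w := by ring
        _ ≤ P ^ 2 * w := by gcongr; exact hw1.trans hP
    · calc (ν * w) ^ 3 = w ^ 2 * ν ^ 3 * w := by ring
        _ ≤ w ^ 2 * ϑ ^ d * w := by
          gcongr
          exact (pow_le_pow_left₀ hν0 hν 3).trans (pow_le_pow_right₀ h hd)
        _ ≤ P ^ 2 * w := by gcongr
  refine le_of_pow_le_pow_left₀ (n := 3) (by norm_num) (by positivity) (hcube.trans ?_)
  calc P ^ 2 * w ≤ P ^ 2 * (P * Real.exp (-(d * t) / 10)) := by gcongr
    _ ≤ P ^ 2 * (P * Real.exp (3 * (-t / 10))) := by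
      gcongr
      have : (3 : ℝ) ≤ d := by exact_mod_cast hd
      nlinarith
    _ = (P * Real.exp (-t / 10)) ^ 3 := by
      rw [mul_pow, ← Real.exp_nat_mul]; push_cast; ring

lemma card_le_of_concentrated {n : ℕ} (c : Fin 3 → ℕ) {i j : Fin 3} (hij : i ≠ j)
    (hi : 20 * c i ≤ n) (hj : 20 * c j ≤ n) :
    (2 ^ n : ℝ)⁻¹ * (Finset.univ.filter fun f : Fin n → Fin 3 => colorCount f = c).card ≤
      (25 / 32) ^ n := by
  have h := card_mul_prod_le (n := n) (fun k => if k = i ∨ k = j then 1 / 8 else 1)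
    (fun k => by split_ifs <;> norm_num) c
  have hsum : ∑ k, (if k = i ∨ k = j then (1 / 8 : ℝ) else 1) = 5 / 4 := by
    fin_cases i <;> fin_cases j <;> simp [Fin.sum_univ_three] at hij ⊢ <;> norm_num
  have hprod : ∏ k, (if k = i ∨ k = j then (1 / 8 : ℝ) else 1) ^ c k = (1 / 8) ^ (c i + c j) := by
    rw [pow_add]
    fin_cases i <;> fin_cases j <;> simp [Fin.prod_univ_three] at hij ⊢ <;> ring
  rw [hsum, hprod] at h
  have h8 : (8 : ℝ) ^ (c i + c j) ≤ (5 / 4) ^ n := by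
    calc (8 : ℝ) ^ (c i + c j) ≤ ((5 / 4) ^ 10) ^ (c i + c j) := by gcongr; norm_num
      _ = (5 / 4) ^ (10 * (c i + c j)) := by rw [pow_mul]
      _ ≤ (5 / 4) ^ n := pow_le_pow_right₀ (by norm_num) (by omega)
  rw [one_div, inv_pow, mul_inv_le_iff₀ (by positivity)] at h
  calc _ ≤ (2 ^ n : ℝ)⁻¹ * ((5 / 4) ^ n * (5 / 4) ^ n) := by
        gcongr; exact h.trans (by gcongr)
    _ = (25 / 32) ^ n := by rw [← inv_pow, ← mul_pow, ← mul_pow]; norm_num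

lemma card_mul_signMean_le {n d : ℕ} (hn : Even n) (hd : 3 ≤ d) (c : Fin 3 → ℕ)
    (hc : ∑ i, c i = n) {t : ℝ} (ht : ∀ i, t ≤ c i) (ht0 : 0 ≤ t) :
    (2 ^ n : ℝ)⁻¹ * (Finset.univ.filter fun f : Fin n → Fin 3 => colorCount f = c).card *
      |signMean fun i => d * c i| ≤
        ((d * n : ℕ) + 1 : ℝ) ^ 2 * Real.exp (-t / 10) + (25 / 32) ^ n := by
  have hs : ∑ i, d * c i = d * n := by rw [← Finset.mul_sum, hc]
  have hw1 := abs_signMean_le_one (fun i => d * c i) (by rw [hs]; exact hn.mul_left d)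
  by_cases h : ∃ i j, i ≠ j ∧ n ≤ 20 * c i ∧ n ≤ 20 * c j
  · obtain ⟨i, j, hij, hi, hj⟩ := h
    exact (card_mul_signMean_le_exp hn hd c hc ht hij hi hj ht0).trans
      (le_add_of_nonneg_right (by positivity))
  · have : ∃ i j, i ≠ j ∧ 20 * c i ≤ n ∧ 20 * c j ≤ n := by
      by_contra! hcon
      push Not at h
      have a01 := h 0 1 (by decide)
      have a02 := h 0 2 (by decide)
      have a12 := h 1 2 (by decide)
      have b01 := hcon 0 1 (by decide)
      have b02 := hcon 0 2 (by decide)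
      have b12 := hcon 1 2 (by decide)
      omega
    obtain ⟨i, j, hij, hi, hj⟩ := this
    refine (mul_le_of_le_one_right (by positivity) hw1).trans
      ((card_le_of_concentrated c hij hi hj).trans (le_add_of_nonneg_left (by positivity)))

/-- Contribution of the colourings in which every colour is used often. -/
lemma sum_large_le {n d : ℕ} (hn : Even n) (hd : 3 ≤ d) {t : ℝ} (ht0 : 0 ≤ t) :
    (2 ^ n : ℝ)⁻¹ * ∑ f : Fin n → Fin 3,
      (if ∀ i, t ≤ colorCount f i then |signMean fun i => d * colorCount f i| else 0) ≤
      ((n : ℝ) + 1) ^ 3 *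
        (((d * n : ℕ) + 1 : ℝ) ^ 2 * Real.exp (-t / 10) + (25 / 32) ^ n) := by
  set S := Fintype.piFinset (fun _ : Fin 3 => Finset.range (n + 1)) with hS
  have hmap : ∀ f : Fin n → Fin 3, colorCount f ∈ S := fun f => by
    rw [hS, Fintype.mem_piFinset]
    intro i
    rw [Finset.mem_range, Nat.lt_succ_iff]
    refine le_trans ?_ (sum_colorCount_fin f).le
    exact Finset.single_le_sum (f := colorCount f) (fun _ _ => Nat.zero_le _) (Finset.mem_univ i)
  rw [← Finset.sum_fiberwise_of_maps_to (fun f _ => hmap f), Finset.mul_sum]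
  have hcard : ((n : ℝ) + 1) ^ 3 = (S.card : ℝ) := by simp [hS]
  rw [hcard, ← nsmul_eq_mul, ← Finset.sum_const]
  refine Finset.sum_le_sum fun c _ => ?_
  have hconst : ∑ f ∈ Finset.univ.filter (fun f : Fin n → Fin 3 => colorCount f = c),
      (if ∀ i, t ≤ colorCount f i then |signMean fun i => d * colorCount f i| else 0) =
      (Finset.univ.filter fun f : Fin n → Fin 3 => colorCount f = c).card *
        (if ∀ i, t ≤ c i then |signMean fun i => d * c i| else 0) := by
    rw [← nsmul_eq_mul, ← Finset.sum_const]
    refine Finset.sum_congr rfl fun f hf => ?_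
    rw [(Finset.mem_filter.1 hf).2]
  rw [hconst, ← mul_assoc]
  split_ifs with ht
  · by_cases hc : ∑ i, c i = n
    · exact card_mul_signMean_le hn hd c hc ht ht0
    · rw [Finset.card_eq_zero.2]
      · simp; positivity
      · refine Finset.filter_eq_empty_iff.2 fun f _ hf => hc ?_
        rw [← hf, sum_colorCount_fin]
  · rw [mul_zero]; positivity

lemma abs_signMean_colorCount_le_pow {n d : ℕ} (hn : Even n) (hd : 3 ≤ d) {z t Δ : ℝ} (hz : 0 < z)
    (hz1 : z ≤ 1) (hn0 : 0 < n) (ht : 6 * t ≤ n) (hΔ : 2 * (Δ + t) < n)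
    (hrec : 2 * (Δ + t) / n * z + 6 * t / n ≤ z ^ 2) (f : Fin n → Fin 3)
    (h0 : (colorCount f 0 : ℝ) < t) (h12 : |(colorCount f 1 : ℝ) - colorCount f 2| ≤ Δ) :
    |signMean fun i => d * colorCount f i| ≤ (z ^ 3) ^ colorCount f 0 := by
  have hs := sum_colorCount_fin f
  have he := even_sum_mul_colorCount d hn f
  have hv : (fun i => d * colorCount f i) =
      ![d * colorCount f 0, d * colorCount f 1, d * colorCount f 2] := by
    funext i; fin_cases i <;> rfl
  rw [hv]
  rw [Fin.sum_univ_three] at hs he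
  have hs' : (colorCount f 0 : ℝ) + colorCount f 1 + colorCount f 2 = n := by exact_mod_cast hs
  have hd0 : (0 : ℝ) < d := by exact_mod_cast (by omega : 0 < d)
  have hn0' : (0 : ℝ) < n := by exact_mod_cast hn0
  have hrec' : d * (Δ + t) / (n * d / 2) * z + 3 * (d * t) / (n * d / 2) ≤ z ^ 2 := by
    refine le_trans (le_of_eq ?_) hrec
    field_simp
    ring
  have h := abs_signMean_le_pow (z := z) (Y := d * (Δ + t)) (K := n * d / 2) (p₀ := d * t) hz
    (by positivity) (by nlinarith) hrec'
    (d * colorCount f 0) (d * colorCount f 1) (d * colorCount f 2) (by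
      push_cast; exact mul_le_mul_of_nonneg_left h0.le hd0.le) he (by
      push_cast
      rw [← mul_sub, abs_mul, abs_of_pos hd0, ← mul_add]
      exact mul_le_mul_of_nonneg_left (add_le_add h12 h0.le) hd0.le) (by
      push_cast
      nlinarith)
  refine h.trans ?_
  rw [← pow_mul]
  exact pow_le_pow_of_le_one hz.le hz1 (Nat.mul_le_mul_right _ hd)

lemma sum_pow_colorCount_pos (n : ℕ) (y : ℝ) :
    (2 ^ n : ℝ)⁻¹ * ∑ f : Fin n → Fin 3, (if 0 < colorCount f 0 then y ^ colorCount f 0 else 0) =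
      (1 + y / 2) ^ n - 1 := by
  have h0 := sum_prod_pow_colorCount n ![0, 1, 1]
  have h1 := sum_prod_pow_colorCount n ![y, 1, 1]
  simp only [Fin.prod_univ_three, Fin.sum_univ_three, Matrix.cons_val_zero, Matrix.cons_val_one,
    Matrix.cons_val, one_pow, mul_one] at h0 h1
  have h : ∀ f : Fin n → Fin 3, (if 0 < colorCount f 0 then y ^ colorCount f 0 else 0) =
      y ^ colorCount f 0 - 0 ^ colorCount f 0 := by
    intro f
    rcases Nat.eq_zero_or_pos (colorCount f 0) with h | h
    · simp [h]
    · simp [h, h.ne']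
  simp_rw [h]
  rw [Finset.sum_sub_distrib, h0, h1, mul_sub, ← inv_pow, ← mul_pow, ← mul_pow]
  ring_nf

/-- Few colourings use colour `0` rarely and are unbalanced in the other two colours. -/
lemma sum_unbalanced_le {n : ℕ} (hn : 0 < n) {t Δ l : ℝ} (hl : 0 ≤ l) :
    (2 ^ n : ℝ)⁻¹ * ∑ f : Fin n → Fin 3,
      (if (colorCount f 0 : ℝ) < t ∧ Δ < |(colorCount f 1 : ℝ) - colorCount f 2| then (1 : ℝ) else 0) ≤
      2 * Real.exp (1 / 2) * ((n : ℝ) ^ t * Real.exp (n * l ^ 2 / 2 - l * Δ)) := by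
  have hn' : (1 : ℝ) ≤ n := by exact_mod_cast hn
  have hn0 : (0 : ℝ) < n := by linarith
  have h1 := sum_prod_pow_colorCount n ![(n : ℝ)⁻¹, Real.exp l, Real.exp (-l)]
  have h2 := sum_prod_pow_colorCount n ![(n : ℝ)⁻¹, Real.exp (-l), Real.exp l]
  simp only [Fin.prod_univ_three, Fin.sum_univ_three, Matrix.cons_val_zero, Matrix.cons_val_one,
    Matrix.cons_val] at h1 h2
  have hpt : ∀ f : Fin n → Fin 3,
      (if (colorCount f 0 : ℝ) < t ∧ Δ < |(colorCount f 1 : ℝ) - colorCount f 2| then (1 : ℝ) else 0) ≤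
      (n : ℝ) ^ t * Real.exp (-(l * Δ)) *
        ((n : ℝ)⁻¹ ^ colorCount f 0 * Real.exp l ^ colorCount f 1 * Real.exp (-l) ^ colorCount f 2 +
        (n : ℝ)⁻¹ ^ colorCount f 0 * Real.exp (-l) ^ colorCount f 1 * Real.exp l ^ colorCount f 2) := by
    intro f
    generalize colorCount f 0 = a
    generalize colorCount f 1 = b
    generalize colorCount f 2 = c
    split_ifs with h
    · obtain ⟨ha, hbc⟩ := h
      have e1 : 1 ≤ (n : ℝ) ^ t * (n : ℝ)⁻¹ ^ a := by
        rw [inv_pow, ← Real.rpow_natCast, ← div_eq_mul_inv, ← Real.rpow_sub hn0]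
        exact Real.one_le_rpow hn' (by linarith)
      have e2 : 1 ≤ Real.exp (-(l * Δ)) * (Real.exp l ^ b * Real.exp (-l) ^ c +
          Real.exp (-l) ^ b * Real.exp l ^ c) := by
        simp only [← Real.exp_nat_mul, ← Real.exp_add, mul_add]
        rcases lt_abs.1 hbc with h | h
        · refine le_trans (Real.one_le_exp ?_) (le_add_of_nonneg_right (Real.exp_pos _).le)
          nlinarith
        · refine le_trans (Real.one_le_exp ?_) (le_add_of_nonneg_left (Real.exp_pos _).le)
          nlinarith
      calc (1 : ℝ) = 1 * 1 := by ring
        _ ≤ _ := mul_le_mul e1 e2 zero_le_one (by positivity)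
        _ = _ := by ring
    · positivity
  have hc := Real.cosh_le_exp_half_sq l
  have hc1 := Real.one_le_cosh l
  have hcosh : Real.exp l + Real.exp (-l) = 2 * Real.cosh l := by rw [Real.cosh_eq]; ring
  have hbase : (2 : ℝ)⁻¹ ^ n * ((n : ℝ)⁻¹ + 2 * Real.cosh l) ^ n ≤
      Real.exp (1 / 2) * Real.exp (n * l ^ 2 / 2) := by
    rw [← mul_pow]
    have e3 : 2⁻¹ * ((n : ℝ)⁻¹ + 2 * Real.cosh l) ≤ Real.exp (1 / (2 * n)) * Real.exp (l ^ 2 / 2) := by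
      have := Real.add_one_le_exp (1 / (2 * n : ℝ))
      have e4 : 2⁻¹ * (n : ℝ)⁻¹ = 1 / (2 * n) := by field_simp
      have e5 : 0 ≤ 1 / (2 * n : ℝ) := by positivity
      calc 2⁻¹ * ((n : ℝ)⁻¹ + 2 * Real.cosh l) = 1 / (2 * n) + Real.cosh l := by rw [← e4]; ring
        _ ≤ (1 / (2 * n) + 1) * Real.cosh l := by nlinarith
        _ ≤ _ := by gcongr
    refine (pow_le_pow_left₀ (by positivity) e3 n).trans (le_of_eq ?_)
    rw [mul_pow, ← Real.exp_nat_mul, ← Real.exp_nat_mul]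
    congr 2
    · field_simp
    · ring
  have hsum := Finset.sum_le_sum fun f (_ : f ∈ Finset.univ) => hpt f
  rw [← Finset.mul_sum, Finset.sum_add_distrib, h1, h2, add_right_comm _ (Real.exp (-l)), add_assoc _ (Real.exp l),
    hcosh] at hsum
  calc _ ≤ (2 ^ n : ℝ)⁻¹ * _ := mul_le_mul_of_nonneg_left hsum (by positivity)
    _ = 2 * ((n : ℝ) ^ t * Real.exp (-(l * Δ))) *
        ((2 : ℝ)⁻¹ ^ n * ((n : ℝ)⁻¹ + 2 * Real.cosh l) ^ n) := by rw [inv_pow]; ring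
    _ ≤ 2 * ((n : ℝ) ^ t * Real.exp (-(l * Δ))) *
        (Real.exp (1 / 2) * Real.exp (n * l ^ 2 / 2)) := by gcongr
    _ = _ := by rw [sub_eq_add_neg, Real.exp_add]; ring

/-- Contribution of the colourings in which colour `0` is used, but rarely. -/
lemma sum_small_le {n d : ℕ} (hn : Even n) (hd : 3 ≤ d) {z t Δ l : ℝ} (hz : 0 < z)
    (hz1 : z ≤ 1) (hn0 : 0 < n) (ht : 6 * t ≤ n) (hΔ : 2 * (Δ + t) < n)
    (hrec : 2 * (Δ + t) / n * z + 6 * t / n ≤ z ^ 2) (hl : 0 ≤ l) :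
    (2 ^ n : ℝ)⁻¹ * ∑ f : Fin n → Fin 3,
      (if 0 < colorCount f 0 ∧ (colorCount f 0 : ℝ) < t then
        |signMean fun i => d * colorCount f i| else 0) ≤
      ((1 + z ^ 3 / 2) ^ n - 1) +
        2 * Real.exp (1 / 2) * ((n : ℝ) ^ t * Real.exp (n * l ^ 2 / 2 - l * Δ)) := by
  rw [← sum_pow_colorCount_pos]
  refine le_trans ?_ (add_le_add_right (sum_unbalanced_le hn0 hl) _)
  rw [← mul_add, ← Finset.sum_add_distrib]
  refine mul_le_mul_of_nonneg_left (Finset.sum_le_sum fun f _ => ?_) (by positivity)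
  by_cases h : 0 < colorCount f 0 ∧ (colorCount f 0 : ℝ) < t
  · rw [if_pos h, if_pos h.1]
    by_cases hb : Δ < |(colorCount f 1 : ℝ) - colorCount f 2|
    · rw [if_pos ⟨h.2, hb⟩]
      have := abs_signMean_le_one _ (even_sum_mul_colorCount d hn f)
      have h3 : 0 ≤ (z ^ 3) ^ colorCount f 0 := by positivity
      linarith
    · rw [if_neg fun hc => hb hc.2, add_zero]
      exact abs_signMean_colorCount_le_pow hn hd hz hz1 hn0 ht hΔ hrec f h.2 (not_lt.1 hb)
  · rw [if_neg h]
    have h3 : 0 ≤ (z ^ 3) ^ colorCount f 0 := by positivity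
    split_ifs <;> linarith

lemma sum_signMean_symm (n d : ℕ) (p : ℕ → Prop) [DecidablePred p] (i : Fin 3) :
    ∑ f : Fin n → Fin 3, (if p (colorCount f i) then |signMean fun i => d * colorCount f i| else 0) =
      ∑ f : Fin n → Fin 3, if p (colorCount f 0) then |signMean fun i => d * colorCount f i| else 0 := by
  set τ : Equiv.Perm (Fin 3) := Equiv.swap 0 i with hτ
  have hc : ∀ (f : Fin n → Fin 3), colorCount (τ ∘ f) = colorCount f ∘ τ := by
    intro f
    funext j
    unfold colorCount
    simp only [Function.comp_apply]
    congr 1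
    ext v
    simp only [Finset.mem_filter, Finset.mem_univ, true_and]
    rw [← Equiv.eq_symm_apply]
    simp [hτ]
  refine Fintype.sum_equiv (Equiv.arrowCongr (Equiv.refl _) τ) _ _ fun f => ?_
  have e : (Equiv.arrowCongr (Equiv.refl (Fin n)) τ) f = τ ∘ f := by
    funext v; simp
  rw [e, hc]
  have e2 : (fun j => d * (colorCount f ∘ τ) j) = (fun j => d * colorCount f j) ∘ τ := rfl
  rw [e2, signMean_comp]
  simp [hτ]

lemma properPart_le {n d : ℕ} (hn : Even n) (hd : 3 ≤ d) {z t Δ l : ℝ} (hz : 0 < z)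
    (hz1 : z ≤ 1) (hn0 : 0 < n) (ht : 6 * t ≤ n) (hΔ : 2 * (Δ + t) < n)
    (hrec : 2 * (Δ + t) / n * z + 6 * t / n ≤ z ^ 2) (hl : 0 ≤ l) (ht0 : 0 ≤ t) :
    properPart n d ≤ ((n : ℝ) + 1) ^ 3 *
        (((d * n : ℕ) + 1 : ℝ) ^ 2 * Real.exp (-t / 10) + (25 / 32) ^ n) +
      3 * (((1 + z ^ 3 / 2) ^ n - 1) +
        2 * Real.exp (1 / 2) * ((n : ℝ) ^ t * Real.exp (n * l ^ 2 / 2 - l * Δ))) := by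
  have h1 := sum_large_le hn hd ht0
  have h2 := sum_small_le hn hd hz hz1 hn0 ht hΔ hrec hl
  refine le_trans ?_ (add_le_add h1 (mul_le_mul_of_nonneg_left h2 (by norm_num)))
  have h3 : (3 : ℝ) * ((2 ^ n : ℝ)⁻¹ * ∑ f : Fin n → Fin 3,
      (if 0 < colorCount f 0 ∧ (colorCount f 0 : ℝ) < t then
        |signMean fun i => d * colorCount f i| else 0)) = (2 ^ n : ℝ)⁻¹ * ∑ f : Fin n → Fin 3,
      ∑ i : Fin 3, (if 0 < colorCount f i ∧ (colorCount f i : ℝ) < t then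
        |signMean fun i => d * colorCount f i| else 0) := by
    rw [Finset.sum_comm]
    classical
    rw [Finset.sum_congr rfl fun i _ => sum_signMean_symm n d (fun k => 0 < k ∧ (k : ℝ) < t) i]
    simp
    ring
  rw [h3, ← mul_add, ← Finset.sum_add_distrib, properPart]
  refine mul_le_mul_of_nonneg_left (Finset.sum_le_sum fun f _ => ?_) (by positivity)
  have hw := abs_nonneg (signMean fun i => d * colorCount f i)
  have hnn : ∀ i ∈ (Finset.univ : Finset (Fin 3)),
      0 ≤ if 0 < colorCount f i ∧ (colorCount f i : ℝ) < t then
        |signMean fun i => d * colorCount f i| else 0 := by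
    intro i _
    split_ifs
    exacts [hw, le_rfl]
  split_ifs with ha hb
  · exact le_add_of_nonneg_right (Finset.sum_nonneg hnn)
  · push Not at hb
    obtain ⟨i, hi⟩ := hb
    rw [zero_add]
    have := Finset.single_le_sum hnn (Finset.mem_univ i)
    rwa [if_pos ⟨ha i, hi⟩] at this
  · exact add_nonneg hw (Finset.sum_nonneg hnn)
  · exact add_nonneg le_rfl (Finset.sum_nonneg hnn)

lemma properPart_le_of_le {n d : ℕ} (hn : Even n) (hd : 3 ≤ d) (hdn : d ≤ n) {t : ℝ}
    (ht : 3 ≤ t) (htn : t ^ 10 = n) :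
    properPart n d ≤
      32 * t ^ 70 * Real.exp (-t / 10) + 8 * ((n : ℝ) ^ 3 * (25 / 32) ^ n) +
        3 * ((Real.exp (125 / 2 * (t ^ 2)⁻¹) - 1) +
          2 * Real.exp (1 / 2) * Real.exp (t ^ 2 * (10 * (Real.log t / t) - 1 / 2))) := by
  have h0 : 0 < t := by linarith
  have h1 : 1 ≤ t := by linarith
  have hnpos : (0 : ℝ) < n := by rw [← htn]; positivity
  have hn1 : (1 : ℝ) ≤ n := by rw [← htn]; exact one_le_pow₀ h1
  have h4 : (81 : ℝ) ≤ t ^ 4 := by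
    calc (81 : ℝ) = 3 ^ 4 := by norm_num
      _ ≤ t ^ 4 := by gcongr
  have ht6 : t ≤ t ^ 6 := le_self_pow₀ h1 (by norm_num)
  have h10 : 81 * t ^ 6 ≤ (n : ℝ) := by
    rw [← htn, show t ^ 10 = t ^ 4 * t ^ 6 by ring]
    gcongr
  have key := properPart_le (n := n) (d := d) (z := 5 / t ^ 4) (t := t) (Δ := t ^ 6)
    (l := (t ^ 4)⁻¹) hn hd (by positivity) (by rw [div_le_one (by positivity)]; linarith)
    (by exact_mod_cast hnpos) (by linarith) (by linarith) (by
      rw [← htn]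
      have e1 : 2 * (t ^ 6 + t) / t ^ 10 * (5 / t ^ 4) + 6 * t / t ^ 10 =
          (10 * (t ^ 6 + t) + 6 * (t * t ^ 4)) / t ^ 14 := by
        field_simp
        ring
      have e2 : (5 / t ^ 4) ^ 2 = 25 * t ^ 6 / t ^ 14 := by
        field_simp
        ring
      rw [e1, e2]
      gcongr
      nlinarith [pow_pos h0 5, mul_le_mul_of_nonneg_right ht (pow_pos h0 5).le]) (by positivity)
      h0.le
  refine key.trans ?_
  have hdn' : (((d * n : ℕ) : ℝ) + 1) ≤ 2 * t ^ 20 := by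
    have : ((d * n : ℕ) : ℝ) ≤ t ^ 20 := by
      rw [show t ^ 20 = t ^ 10 * t ^ 10 by ring, htn, Nat.cast_mul]
      gcongr
    linarith [one_le_pow₀ h1 (n := 20)]
  have hn2 : (n : ℝ) + 1 ≤ 2 * n := by linarith
  have hz : (1 + (5 / t ^ 4) ^ 3 / 2) ^ n ≤ Real.exp (125 / 2 * (t ^ 2)⁻¹) := by
    calc (1 + (5 / t ^ 4) ^ 3 / 2) ^ n ≤ (Real.exp ((5 / t ^ 4) ^ 3 / 2)) ^ n := by
          gcongr
          rw [add_comm]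
          exact Real.add_one_le_exp _
      _ = Real.exp (125 / 2 * (t ^ 2)⁻¹) := by
          rw [← Real.exp_nat_mul, ← htn]
          congr 1
          field_simp
          norm_num
  have he : (n : ℝ) ^ t * Real.exp (n * (t ^ 4)⁻¹ ^ 2 / 2 - (t ^ 4)⁻¹ * t ^ 6) =
      Real.exp (t ^ 2 * (10 * (Real.log t / t) - 1 / 2)) := by
    rw [Real.rpow_def_of_pos hnpos, ← Real.exp_add, ← htn, Real.log_pow]
    congr 1
    field_simp
    push_cast
    ring
  rw [he]
  have hp : ((n : ℝ) + 1) ^ 3 * (((d * n : ℕ) + 1 : ℝ) ^ 2 * Real.exp (-t / 10) + (25 / 32) ^ n) ≤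
      (2 * n) ^ 3 * ((2 * t ^ 20) ^ 2 * Real.exp (-t / 10) + (25 / 32) ^ n) := by
    gcongr
  have hp2 : (2 * (n : ℝ)) ^ 3 * ((2 * t ^ 20) ^ 2 * Real.exp (-t / 10) + (25 / 32) ^ n) =
      32 * t ^ 70 * Real.exp (-t / 10) + 8 * ((n : ℝ) ^ 3 * (25 / 32) ^ n) := by
    have : (n : ℝ) ^ 3 = t ^ 30 := by rw [← htn]; ring
    rw [mul_add, mul_pow, this]
    ring
  linarith

lemma tendsto_properPart_bound :
    Filter.Tendsto (fun t : ℝ => 32 * t ^ 70 * Real.exp (-t / 10) +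
        3 * ((Real.exp (125 / 2 * (t ^ 2)⁻¹) - 1) +
          2 * Real.exp (1 / 2) * Real.exp (t ^ 2 * (10 * (Real.log t / t) - 1 / 2))))
      Filter.atTop (nhds 0) := by
  have hA : Filter.Tendsto (fun t : ℝ => 32 * t ^ 70 * Real.exp (-t / 10))
      Filter.atTop (nhds 0) := by
    have h := ((Real.tendsto_pow_mul_exp_neg_atTop_nhds_zero 70).comp
      (Filter.tendsto_id.atTop_div_const (show (0 : ℝ) < 10 by norm_num))).const_mul (32 * 10 ^ 70)
    rw [mul_zero] at h
    refine h.congr fun t => ?_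
    simp only [Function.comp_apply, id_eq, div_pow, neg_div]
    field_simp
  have hsq : Filter.Tendsto (fun t : ℝ => t ^ 2) Filter.atTop Filter.atTop :=
    Filter.tendsto_pow_atTop two_ne_zero
  have hB : Filter.Tendsto (fun t : ℝ => Real.exp (125 / 2 * (t ^ 2)⁻¹) - 1)
      Filter.atTop (nhds 0) := by
    have h := (Real.continuous_exp.tendsto (125 / 2 * 0)).comp
      (hsq.inv_tendsto_atTop.const_mul (125 / 2))
    simpa using h.sub_const 1
  have hC : Filter.Tendsto (fun t : ℝ => Real.exp (t ^ 2 * (10 * (Real.log t / t) - 1 / 2)))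
      Filter.atTop (nhds 0) := by
    refine Real.tendsto_exp_atBot.comp ?_
    have h : Filter.Tendsto (fun t : ℝ => Real.log t / t) Filter.atTop (nhds 0) :=
      Real.isLittleO_log_id_atTop.tendsto_div_nhds_zero
    exact hsq.atTop_mul_neg (C := 10 * 0 - 1 / 2) (by norm_num) ((h.const_mul 10).sub_const _)
  simpa using hA.add ((hB.add (hC.const_mul (2 * Real.exp (1 / 2)))).const_mul 3)

lemma tendsto_pairingAvgM2_sub (d : ℕ → ℕ) (hd3 : ∀ n, 3 ≤ d n)
    (hdsub : Filter.Tendsto (fun n => (d n : ℝ) / Real.sqrt n) Filter.atTop (nhds 0)) :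
    Filter.Tendsto (fun n => pairingAvgM2 n (d n) - (2 + ((1 + (-1) ^ d n) / 2) ^ n))
      (Filter.atTop ⊓ Filter.principal {n | Even n}) (nhds 0) := by
  have hroot : Filter.Tendsto (fun n : ℕ => (n : ℝ) ^ (1 / 10 : ℝ)) Filter.atTop Filter.atTop :=
    (tendsto_rpow_atTop (by norm_num)).comp tendsto_natCast_atTop_atTop
  have hgeom : Filter.Tendsto (fun n : ℕ => 8 * ((n : ℝ) ^ 3 * (25 / 32) ^ n) + 9 * (2 ^ n : ℝ)⁻¹)
      Filter.atTop (nhds 0) := by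
    have h1 := tendsto_pow_const_mul_const_pow_of_abs_lt_one 3
      (r := (25 / 32 : ℝ)) (by rw [abs_lt]; norm_num)
    have h2 := tendsto_pow_const_mul_const_pow_of_abs_lt_one 0
      (r := (1 / 2 : ℝ)) (by rw [abs_lt]; norm_num)
    simpa using (h1.const_mul 8).add (h2.const_mul 9)
  have hbound := (tendsto_properPart_bound.comp hroot).add hgeom
  rw [add_zero] at hbound
  refine squeeze_zero_norm' ?_ (hbound.mono_left inf_le_left)
  rw [Filter.eventually_inf_principal]
  filter_upwards [hroot.eventually_ge_atTop 3, hdsub.eventually_le_const one_pos,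
    Filter.eventually_ge_atTop 1] with n ht hdn hn1 hn
  have hsqrt : (1 : ℝ) ≤ Real.sqrt n := Real.one_le_sqrt.2 (by exact_mod_cast hn1)
  have hdn' : d n ≤ n := by
    have h1 : (d n : ℝ) ≤ Real.sqrt n := by rwa [div_le_one (by linarith)] at hdn
    have h2 : Real.sqrt n ≤ n := by
      nlinarith [Real.mul_self_sqrt (Nat.cast_nonneg (α := ℝ) n)]
    exact_mod_cast h1.trans h2
  have htn : ((n : ℝ) ^ (1 / 10 : ℝ)) ^ 10 = n := by
    rw [← Real.rpow_natCast, ← Real.rpow_mul (Nat.cast_nonneg n)]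
    norm_num
  have h1 := abs_pairingAvgM2_sub_le (d n) hn
  have h2 := properPart_le_of_le hn (hd3 n) hdn' ht htn
  rw [Real.norm_eq_abs]
  simp only [Function.comp_apply]
  linarith

/-- anticoncentration of the random pairing model. For `d_n ≥ 3` with
`d_n/√n → 0`, along even `n` the average second moment tends to `2` if all `d_n` are
odd and to `3` if all `d_n` are even. -/
theorem stmt_3 (d : ℕ → ℕ) (hd3 : ∀ n, 3 ≤ d n)
    (hdsub : Filter.Tendsto (fun n => (d n : ℝ) / Real.sqrt n) Filter.atTop (nhds 0)) :
    ((∀ n, Odd (d n)) →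
      Filter.Tendsto (fun n => pairingAvgM2 n (d n))
        (Filter.atTop ⊓ Filter.principal {n | Even n}) (nhds 2)) ∧
    ((∀ n, Even (d n)) →
      Filter.Tendsto (fun n => pairingAvgM2 n (d n))
        (Filter.atTop ⊓ Filter.principal {n | Even n}) (nhds 3)) := by
  have h := tendsto_pairingAvgM2_sub d hd3 hdsub
  constructor
  · intro hodd
    have h' := h.add_const 2
    rw [zero_add] at h'
    refine h'.congr' (Filter.Eventually.filter_mono inf_le_left ?_)
    filter_upwards [Filter.eventually_ge_atTop 1] with n hn
    simp [(hodd n).neg_one_pow, show n ≠ 0 by omega]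
  · intro heven
    have h' := h.add_const 3
    rw [zero_add] at h'
    refine h'.congr fun n => ?_
    rw [(heven n).neg_one_pow]
    norm_num
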